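/- arXiv:1704.05314 — 10 statements merged into one kernel-verified Lean document; each statement's English description precedes it below -/
import Mathlib

section
/- Let T>0, 0<p₁≤p₂ and P∈ℝ with p₁T ≤ P ≤ p₂T. Let Λ>0 and λ : ℕ → ℝ satisfy λ i ≥ Λ for all i. Let a : ℕ → ℝ be such that E := (Σᵢ λ i · (a i)²)^{1/2} < ∞ and ‖a‖ > 0. Let δ > 0 and f : ℕ → ℝ satisfy Σᵢ (f i − a i · e^{−λ i · P})² ≤ δ². Then there exists a square-summable g : ℕ → ℝ such that for every ζ > δ²/(2Λp₂T‖a‖²) one has ‖a − g‖ ≤ √((1+ζ)p₂T) · E / √( ln( √(2ζΛp₂T) · ‖a‖/δ ) ). -/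
/-- The reconstruction of the initial coefficients from the data `f` at time `T`: a spectral
filter with cutoff frequency `M`, which uses only `P`, `M`, the eigenvalues and the data. -/
noncomputable def backwardFilter (P M : ℝ) (lam f : ℕ → ℝ) (i : ℕ) : ℝ :=
  Real.exp (2 * M * P) * Real.exp (-(lam i) * P) * f i /
    (2 * P * lam i + Real.exp (2 * P * (M - lam i)))

/-- Both error contributions of the filter, frequency by frequency. The weights come from the
tangent line inequality `1 + x ≤ exp x` at the cutoff frequency. -/
theorem backwardFilter_sq_error_le {P M : ℝ} {lam f : ℕ → ℝ} {i : ℕ} (hP : 0 ≤ P) (hM : 0 ≤ M)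
    (hlam : 0 ≤ lam i) (x : ℝ) :
    (1 + 2 * P * M) * (x - backwardFilter P M lam f i) ^ 2 ≤
      2 * P * (lam i * x ^ 2) +
        Real.exp (2 * M * P) * (f i - x * Real.exp (-(lam i) * P)) ^ 2 := by
  unfold backwardFilter
  set k := Real.exp (-(lam i) * P)
  set B := Real.exp (2 * M * P)
  have hB : 0 < B := Real.exp_pos _
  have hexp : Real.exp (2 * P * (M - lam i)) = B * k ^ 2 := by
    rw [← Real.exp_nat_mul, ← Real.exp_add]
    congr 1
    push_cast
    ring
  have htangent := Real.add_one_le_exp (2 * P * (M - lam i))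
  rw [hexp] at htangent ⊢
  have hD : 1 + 2 * P * M ≤ 2 * P * lam i + B * k ^ 2 := by linarith
  have hDpos : 0 < 2 * P * lam i + B * k ^ 2 := by
    have : 0 ≤ P * M := mul_nonneg hP hM
    linarith
  have hcenter : 2 * P * (lam i * x ^ 2) + B * (f i - x * k) ^ 2 =
      (2 * P * lam i + B * k ^ 2) * (x - B * k * f i / (2 * P * lam i + B * k ^ 2)) ^ 2 +
        2 * P * lam i * B * f i ^ 2 / (2 * P * lam i + B * k ^ 2) := by
    field_simp
    ring
  have hrest : 0 ≤ 2 * P * lam i * B * f i ^ 2 / (2 * P * lam i + B * k ^ 2) := by positivity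
  rw [hcenter]
  linarith [mul_le_mul_of_nonneg_right hD
    (sq_nonneg (x - B * k * f i / (2 * P * lam i + B * k ^ 2)))]

/-- The total error of the filter for data with squared noise level `ε`. -/
theorem backwardFilter_summable_and_tsum_le {P M ε : ℝ} {lam a f : ℕ → ℝ} (hP : 0 ≤ P)
    (hM : 0 ≤ M) (hlam : ∀ i, 0 ≤ lam i) (hE : Summable fun i => lam i * a i ^ 2)
    (hf : Summable fun i => (f i - a i * Real.exp (-(lam i) * P)) ^ 2)
    (hfε : ∑' i, (f i - a i * Real.exp (-(lam i) * P)) ^ 2 ≤ ε) :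
    (Summable fun i => (a i - backwardFilter P M lam f i) ^ 2) ∧
      (1 + 2 * P * M) * ∑' i, (a i - backwardFilter P M lam f i) ^ 2 ≤
        2 * P * ∑' i, lam i * a i ^ 2 + Real.exp (2 * M * P) * ε := by
  have hpos : 0 < 1 + 2 * P * M := by positivity
  have hle i := backwardFilter_sq_error_le (f := f) hP hM (hlam i) (a i)
  have hsum := (hE.mul_left (2 * P)).add (hf.mul_left (Real.exp (2 * M * P)))
  have herr : Summable fun i => (1 + 2 * P * M) * (a i - backwardFilter P M lam f i) ^ 2 :=
    hsum.of_nonneg_of_le (fun i => by positivity) hle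
  refine ⟨(summable_mul_left_iff hpos.ne').1 herr, ?_⟩
  rw [← tsum_mul_left]
  refine (herr.tsum_le_tsum hle hsum).trans ?_
  rw [(hE.mul_left (2 * P)).tsum_add (hf.mul_left _), tsum_mul_left, tsum_mul_left]
  gcongr

/-- The cutoff frequency balancing the two error contributions. -/
theorem exists_mul_exp_eq {P y : ℝ} (hP : 0 ≤ P) (hy : 0 < y) :
    ∃ M : ℝ, 0 < M ∧ M * Real.exp (2 * M * P) = y := by
  have hcont : Continuous fun M : ℝ => M * Real.exp (2 * M * P) := by fun_prop
  have hup : y ≤ y * Real.exp (2 * y * P) :=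
    le_mul_of_one_le_right hy.le (Real.one_le_exp (by positivity))
  obtain ⟨M, hM, hMy⟩ := intermediate_value_Icc hy.le hcont.continuousOn
    (show y ∈ Set.Icc _ _ from ⟨by simpa using hy.le, hup⟩)
  refine ⟨M, hM.1.lt_of_ne ?_, hMy⟩
  rintro rfl
  simp at hMy
  exact hy.ne hMy

/-- The logarithm in the rate is controlled by the cutoff frequency. -/
theorem log_sqrt_le_of_le_mul_exp {P Q M ζ z : ℝ} (hPQ : P ≤ Q) (hQ : 0 < Q) (hM : 0 < M)
    (hζ : 0 < ζ) (hz : 0 < z) (hzM : z ≤ M * Real.exp (2 * M * P)) :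
    Real.log (Real.sqrt (2 * ζ * Q * z)) ≤ (1 + ζ) * Q * M := by
  rw [Real.log_sqrt (by positivity)]
  have hlog : Real.log (2 * ζ * Q * z) ≤ Real.log (2 * ζ * Q * M) + 2 * M * P := by
    rw [← Real.log_exp (2 * M * P), ← Real.log_mul (by positivity) (by positivity)]
    refine Real.log_le_log (by positivity) ?_
    rw [mul_assoc _ M]
    gcongr
  have hlin := Real.log_le_sub_one_of_pos (show 0 < 2 * ζ * Q * M by positivity)
  have := mul_le_mul_of_nonneg_left hPQ hM.le
  linarith

/-- Global backward heat problem (spectral form): from a `δ`-noisy observation `f` of the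
coefficients `a i * exp (-(λ i) * P)` of the solution at time `T`, one can reconstruct the
initial coefficients `a` with logarithmic accuracy, for every admissible parameter `ζ`. -/
theorem global_backward_problem
    (T p₁ p₂ P Λ δ : ℝ) (lam a f : ℕ → ℝ)
    (hT : 0 < T) (hp₁ : 0 < p₁) (hp₁₂ : p₁ ≤ p₂)
    (hP₁ : p₁ * T ≤ P) (hP₂ : P ≤ p₂ * T)
    (hΛ : 0 < Λ) (hlam : ∀ i, Λ ≤ lam i)
    (hE : Summable (fun i => lam i * (a i) ^ 2))
    (ha : 0 < Real.sqrt (∑' i, (a i) ^ 2))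
    (hδ : 0 < δ)
    (hf : Summable (fun i => (f i - a i * Real.exp (-(lam i) * P)) ^ 2))
    (hfδ : (∑' i, (f i - a i * Real.exp (-(lam i) * P)) ^ 2) ≤ δ ^ 2) :
    ∃ g : ℕ → ℝ, Summable (fun i => (g i) ^ 2) ∧
      ∀ ζ : ℝ, δ ^ 2 / (2 * Λ * p₂ * T * (Real.sqrt (∑' i, (a i) ^ 2)) ^ 2) < ζ →
        Real.sqrt (∑' i, (a i - g i) ^ 2) ≤
          Real.sqrt ((1 + ζ) * p₂ * T) * Real.sqrt (∑' i, lam i * (a i) ^ 2) /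
            Real.sqrt (Real.log (Real.sqrt (2 * ζ * Λ * p₂ * T) *
              Real.sqrt (∑' i, (a i) ^ 2) / δ)) := by
  set N := ∑' i, (a i) ^ 2
  set E2 := ∑' i, lam i * (a i) ^ 2
  have hP : 0 ≤ P := (mul_pos hp₁ hT).le.trans hP₁
  have hlam0 i : 0 ≤ lam i := hΛ.le.trans (hlam i)
  have hQ : 0 < p₂ * T := mul_pos (hp₁.trans_le hp₁₂) hT
  have hN : 0 < N := Real.sqrt_pos.1 ha
  have ha2 : Summable fun i => (a i) ^ 2 := by
    by_contra h
    exact hN.ne' (tsum_eq_zero_of_not_summable h)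
  have hΛN : Λ * N ≤ E2 := by
    rw [← tsum_mul_left]
    exact (ha2.mul_left Λ).tsum_le_tsum
      (fun i => mul_le_mul_of_nonneg_right (hlam i) (sq_nonneg _)) hE
  have hE2 : 0 < E2 := (mul_pos hΛ hN).trans_le hΛN
  obtain ⟨M, hM, hMδ⟩ := exists_mul_exp_eq hP (show 0 < E2 / δ ^ 2 by positivity)
  obtain ⟨herr, hbound⟩ :=
    backwardFilter_summable_and_tsum_le hP hM.le hlam0 hE hf hfδ
  refine ⟨backwardFilter P M lam f, ?_, fun ζ hζ => ?_⟩
  · refine ((ha2.mul_left 2).add (herr.mul_left 2)).of_nonneg_of_le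
      (fun i => sq_nonneg _) fun i => ?_
    nlinarith [sq_nonneg (2 * a i - backwardFilter P M lam f i)]
  set S := ∑' i, (a i - backwardFilter P M lam f i) ^ 2
  have hS : S * M ≤ E2 := by
    have hbal : M * (Real.exp (2 * M * P) * δ ^ 2) = E2 := by
      rw [← mul_assoc, hMδ]
      field_simp
    refine le_of_mul_le_mul_left ?_ (show 0 < 1 + 2 * P * M by positivity)
    linarith [mul_le_mul_of_nonneg_left hbound hM.le]
  rw [Real.sq_sqrt hN.le] at hζ
  have hden : 0 < 2 * Λ * p₂ * T * N := by
    have : 0 < p₂ := hp₁.trans_le hp₁₂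
    positivity
  have hζ0 : 0 < ζ := lt_trans (by positivity) hζ
  have hone : 1 < 2 * ζ * (p₂ * T) * (Λ * N / δ ^ 2) := by
    rw [div_lt_iff₀ hden] at hζ
    rw [← mul_div_assoc, one_lt_div (by positivity)]
    linarith
  have harg : Real.sqrt (2 * ζ * Λ * p₂ * T) * Real.sqrt N / δ =
      Real.sqrt (2 * ζ * (p₂ * T) * (Λ * N / δ ^ 2)) := by
    rw [← Real.sqrt_mul' _ hN.le, ← mul_div_assoc, Real.sqrt_div' _ (sq_nonneg δ),
      Real.sqrt_sq hδ.le]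
    ring_nf
  rw [harg]
  have hlog : 0 < Real.log (Real.sqrt (2 * ζ * (p₂ * T) * (Λ * N / δ ^ 2))) :=
    Real.log_pos (Real.lt_sqrt_of_sq_lt (by simpa using hone))
  have hrate := log_sqrt_le_of_le_mul_exp hP₂ hQ hM hζ0
    (show 0 < Λ * N / δ ^ 2 by positivity) (by rw [hMδ]; gcongr)
  rw [← Real.sqrt_mul' _ hE2.le, ← Real.sqrt_div' _ hlog.le]
  refine Real.sqrt_le_sqrt ((le_div_iff₀ hlog).2 ?_)
  have hS0 : 0 ≤ S := tsum_nonneg fun i => sq_nonneg _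
  calc S * Real.log (Real.sqrt (2 * ζ * (p₂ * T) * (Λ * N / δ ^ 2)))
      ≤ S * ((1 + ζ) * (p₂ * T) * M) := mul_le_mul_of_nonneg_left hrate hS0
    _ = (1 + ζ) * (p₂ * T) * (S * M) := by ring
    _ ≤ (1 + ζ) * (p₂ * T) * E2 := by gcongr
    _ = (1 + ζ) * p₂ * T * E2 := by ring
end

section
/- Let P > 0, Λ > 0 and λ : ℕ → ℝ with λ i ≥ Λ for all i. Let a : ℕ → ℝ with E := (Σᵢ λ i · (a i)²)^{1/2} < ∞, let δ > 0 and f : ℕ → ℝ with Σᵢ (f i − a i · e^{−λ i · P})² ≤ δ², and let β > 0. Define g : ℕ → ℝ by g i := min(e^{λ i · P}, β) · f i. Then g is square-summable and ‖a − g‖ ≤ β·δ + ( sup_{λ ≥ Λ} (1 − β e^{−λP})/√λ ) · E, the supremum being over real λ ∈ [Λ, ∞). -/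
/-- Minkowski's inequality for square-summable real sequences, in terms of a pointwise bound. -/
theorem summable_sq_and_sqrt_tsum_sq_le {ι : Type*} {x u v : ι → ℝ}
    (hu₀ : ∀ i, 0 ≤ u i) (hv₀ : ∀ i, 0 ≤ v i)
    (hu : Summable fun i => u i ^ 2) (hv : Summable fun i => v i ^ 2)
    (hx : ∀ i, |x i| ≤ u i + v i) :
    Summable (fun i => x i ^ 2) ∧
      √(∑' i, x i ^ 2) ≤ √(∑' i, u i ^ 2) + √(∑' i, v i ^ 2) := by
  obtain ⟨hs, hle⟩ := Real.Lp_add_le_tsum_of_nonneg (p := 2) one_le_two hu₀ hv₀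
    (by simpa using hu) (by simpa using hv)
  simp only [Real.rpow_two, ← Real.sqrt_eq_rpow] at hs hle
  have hsq : ∀ i, x i ^ 2 ≤ (u i + v i) ^ 2 := fun i =>
    sq_le_sq.mpr ((hx i).trans (le_abs_self _))
  have hxs : Summable fun i => x i ^ 2 := hs.of_nonneg_of_le (fun i => sq_nonneg _) hsq
  exact ⟨hxs, (Real.sqrt_le_sqrt (hxs.tsum_le_tsum hsq hs)).trans hle⟩

theorem bddAbove_filter_bias {P Λ β : ℝ} (hΛ : 0 < Λ) (hβ : 0 ≤ β) :
    BddAbove (Set.range fun l : Set.Ici Λ =>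
      (1 - β * Real.exp (-(l : ℝ) * P)) / √(l : ℝ)) := by
  refine ⟨1 / √Λ, ?_⟩
  rintro _ ⟨⟨l, hl⟩, rfl⟩
  have hl : Λ ≤ l := hl
  have : 0 ≤ β * Real.exp (-l * P) := by positivity
  exact div_le_div₀ zero_le_one (by linarith) (Real.sqrt_pos.mpr hΛ) (Real.sqrt_le_sqrt hl)

theorem iSup_filter_bias_nonneg {P Λ β : ℝ} (hP : 0 < P) (hΛ : 0 < Λ) (hβ : 0 < β) :
    0 ≤ ⨆ l : Set.Ici Λ, (1 - β * Real.exp (-(l : ℝ) * P)) / √(l : ℝ) := by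
  refine le_ciSup_of_le (bddAbove_filter_bias hΛ hβ.le)
    ⟨max Λ (Real.log β / P), Set.mem_Ici.mpr (le_max_left _ _)⟩ (div_nonneg ?_ (Real.sqrt_nonneg _))
  have hlog : Real.log β ≤ max Λ (Real.log β / P) * P :=
    (div_le_iff₀ hP).mp (le_max_right _ _)
  have hle : β ≤ Real.exp (max Λ (Real.log β / P) * P) := (Real.log_le_iff_le_exp hβ).mp hlog
  rw [sub_nonneg, neg_mul, Real.exp_neg, ← div_eq_mul_inv]
  exact (div_le_one (Real.exp_pos _)).mpr hle

/-- The damping of a single mode by the filter is controlled by any nonnegative bound on the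
bias factor at that mode. -/
theorem abs_one_sub_filter_mul_exp_le {P β l M : ℝ} (hl : 0 < l) (hM : 0 ≤ M)
    (h : (1 - β * Real.exp (-l * P)) / √l ≤ M) :
    |1 - min (Real.exp (l * P)) β * Real.exp (-l * P)| ≤ M * √l := by
  have hexp : Real.exp (l * P) * Real.exp (-l * P) = 1 := by
    rw [← Real.exp_add]; simp
  rcases le_total (Real.exp (l * P)) β with hc | hc
  · rw [min_eq_left hc, hexp]
    simpa using mul_nonneg hM (Real.sqrt_nonneg l)
  · have hle := mul_le_mul_of_nonneg_right hc (Real.exp_pos (-l * P)).le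
    rw [min_eq_right hc, abs_of_nonneg (by linarith)]
    exact (div_le_iff₀ (Real.sqrt_pos.mpr hl)).mp h


/-- Error decomposition (noise amplification plus bias) for Seidman's optimal-filtering
regularization, in spectral-coefficient form: the filtered reconstruction
`g i = min (exp (λ i · P)) β · f i` is square-summable and its error is bounded by
`β·δ` plus the bias factor `sup_{λ ≥ Λ} (1 − β e^{−λP})/√λ` times `E`. -/
theorem filter_error_decomposition
    (P Λ δ β : ℝ) (lam a f : ℕ → ℝ)
    (hP : 0 < P) (hΛ : 0 < Λ) (hlam : ∀ i, Λ ≤ lam i)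
    (hE : Summable (fun i => lam i * (a i) ^ 2))
    (hδ : 0 < δ)
    (hf : Summable (fun i => (f i - a i * Real.exp (-(lam i) * P)) ^ 2))
    (hfδ : (∑' i, (f i - a i * Real.exp (-(lam i) * P)) ^ 2) ≤ δ ^ 2)
    (hβ : 0 < β)
    (g : ℕ → ℝ) (hg : ∀ i, g i = min (Real.exp (lam i * P)) β * f i) :
    Summable (fun i => (g i) ^ 2) ∧
      Real.sqrt (∑' i, (a i - g i) ^ 2) ≤
        β * δ +
          (⨆ l : Set.Ici Λ, (1 - β * Real.exp (-(l : ℝ) * P)) / Real.sqrt (l : ℝ)) *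
            Real.sqrt (∑' i, lam i * (a i) ^ 2) := by
  set M := ⨆ l : Set.Ici Λ, (1 - β * Real.exp (-(l : ℝ) * P)) / √(l : ℝ)
  have hM : 0 ≤ M := iSup_filter_bias_nonneg hP hΛ hβ
  have hlam_pos : ∀ i, 0 < lam i := fun i => hΛ.trans_le (hlam i)
  have hnoise_eq : ∀ i, (β * |f i - a i * Real.exp (-(lam i) * P)|) ^ 2 =
      β ^ 2 * (f i - a i * Real.exp (-(lam i) * P)) ^ 2 := fun i => by
    rw [mul_pow, sq_abs]
  have hbias_eq : ∀ i, (M * √(lam i) * |a i|) ^ 2 = M ^ 2 * (lam i * a i ^ 2) := fun i => by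
    rw [mul_pow, mul_pow, sq_abs, Real.sq_sqrt (hlam_pos i).le, mul_assoc]
  have hpt : ∀ i, |a i - g i| ≤
      β * |f i - a i * Real.exp (-(lam i) * P)| + M * √(lam i) * |a i| := fun i => by
    have hw : |min (Real.exp (lam i * P)) β| ≤ β := by
      rw [abs_of_nonneg (le_min (Real.exp_pos _).le hβ.le)]
      exact min_le_right _ _
    have hb := abs_one_sub_filter_mul_exp_le (hlam_pos i) hM
      (le_ciSup (bddAbove_filter_bias (P := P) hΛ hβ.le) ⟨lam i, hlam i⟩)
    have hsplit : a i - g i =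
        -(min (Real.exp (lam i * P)) β * (f i - a i * Real.exp (-(lam i) * P))) +
          (1 - min (Real.exp (lam i * P)) β * Real.exp (-(lam i) * P)) * a i := by
      rw [hg]; ring
    rw [hsplit]
    refine (abs_add_le _ _).trans ?_
    rw [abs_neg, abs_mul, abs_mul]
    gcongr
  obtain ⟨hsum, hle⟩ := summable_sq_and_sqrt_tsum_sq_le
    (fun i => by positivity) (fun i => by positivity)
    ((hf.mul_left (β ^ 2)).congr fun i => (hnoise_eq i).symm)
    ((hE.mul_left (M ^ 2)).congr fun i => (hbias_eq i).symm) hpt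
  have ha : Summable fun i => a i ^ 2 := by
    refine (hE.mul_left Λ⁻¹).of_nonneg_of_le (fun i => sq_nonneg _) fun i => ?_
    rw [← div_eq_inv_mul, le_div_iff₀ hΛ, mul_comm]
    exact mul_le_mul_of_nonneg_right (hlam i) (sq_nonneg _)
  refine ⟨(summable_sq_and_sqrt_tsum_sq_le (fun i => abs_nonneg (a i))
    (fun i => abs_nonneg (a i - g i)) (by simpa using ha) (by simpa using hsum)
    fun i => ?_).1, ?_⟩
  · simpa using abs_sub (a i) (a i - g i)
  · simp only [hnoise_eq, hbias_eq, tsum_mul_left, Real.sqrt_mul (sq_nonneg _),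
      Real.sqrt_sq hβ.le, Real.sqrt_sq hM] at hle
    refine hle.trans ?_
    gcongr
    exact Real.sqrt_le_iff.mpr ⟨hδ.le, hfδ⟩
end

section
/- Let c > 0, L > 0 and β > e^{Lc}/(1 + 2Lc). Then there exists a unique λ̄ > L satisfying β = e^{λ̄ c}/(1 + 2λ̄ c), and for every real λ ≥ L one has (1 − β e^{−λ c})/√(λ c) ≤ (1 − β e^{−λ̄ c})/√(λ̄ c); that is, the function λ ↦ (1 − β e^{−λ c})/√(λ c) attains its supremum over [L, ∞) at λ̄. -/
/-- The three-point convexity inequality for `x ↦ exp x - β * (1 + 2 * x)`. -/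
theorem exp_sub_affine_three_point (β : ℝ) {p q r : ℝ} (hpq : p < q) (hqr : q < r) :
    (r - p) * (Real.exp q - β * (1 + 2 * q)) ≤
      (r - q) * (Real.exp p - β * (1 + 2 * p)) + (q - p) * (Real.exp r - β * (1 + 2 * r)) := by
  have h := convexOn_exp.slope_mono_adjacent (Set.mem_univ p) (Set.mem_univ r) hpq hqr
  rw [div_le_div_iff₀ (by linarith) (by linarith)] at h
  linarith

/-- If `β` exceeds `exp a / (1 + 2 * a)`, then `exp x = β * (1 + 2 * x)` has a solution `x > a`. -/
theorem exists_exp_eq_affine {a β : ℝ} (ha : 0 < a) (hβ : 0 < β)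
    (h : Real.exp a - β * (1 + 2 * a) < 0) :
    ∃ y, a < y ∧ Real.exp y - β * (1 + 2 * y) = 0 := by
  have hpos : 0 < Real.exp (a + 4 * β + 2) - β * (1 + 2 * (a + 4 * β + 2)) := by
    have := Real.quadratic_le_exp_of_nonneg (x := a + 4 * β + 2) (by positivity)
    nlinarith [mul_pos ha hβ, sq_nonneg a, sq_nonneg β]
  obtain ⟨y, hy, hy0⟩ := intermediate_value_Ioo
    (f := fun x : ℝ => Real.exp x - β * (1 + 2 * x)) (show a ≤ a + 4 * β + 2 by linarith)
    (by fun_prop) ⟨h, hpos⟩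
  exact ⟨y, hy.1, hy0⟩

theorem hasDerivAt_one_sub_mul_exp_neg_div_sqrt (β : ℝ) {x : ℝ} (hx : 0 < x) :
    HasDerivAt (fun x => (1 - β * Real.exp (-x)) / Real.sqrt x)
      (-(Real.exp x - β * (1 + 2 * x)) * (Real.exp (-x) / (2 * Real.sqrt x * x))) x := by
  have hs : 0 < Real.sqrt x := Real.sqrt_pos.2 hx
  have h := ((((hasDerivAt_neg x).exp.const_mul β).const_sub 1).div
    (Real.hasDerivAt_sqrt hx.ne') hs.ne')
  refine h.congr_deriv ?_
  have he : Real.exp x * Real.exp (-x) = 1 := by rw [← Real.exp_add]; simp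
  have hsq : Real.sqrt x ^ 2 = x := Real.sq_sqrt hx.le
  rw [hsq]
  field_simp
  rw [hsq]
  linear_combination he

/-- If `x ↦ exp x - β * (1 + 2 * x)` is negative at `a` and vanishes at `y > a`, then
`x ↦ (1 - β * exp (-x)) / √x` is maximal on `[a, ∞)` at `y`. -/
theorem one_sub_mul_exp_neg_div_sqrt_le {a y β x : ℝ} (ha : 0 < a)
    (h : Real.exp a - β * (1 + 2 * a) < 0) (hay : a < y)
    (hy : Real.exp y - β * (1 + 2 * y) = 0) (hx : a ≤ x) :
    (1 - β * Real.exp (-x)) / Real.sqrt x ≤ (1 - β * Real.exp (-y)) / Real.sqrt y := by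
  rcases le_total x y with hxy | hxy
  · refine monotoneOn_of_hasDerivWithinAt_nonneg (convex_Icc a y)
      (fun z hz => (hasDerivAt_one_sub_mul_exp_neg_div_sqrt β
        (ha.trans_le hz.1)).continuousAt.continuousWithinAt)
      (fun z hz => (hasDerivAt_one_sub_mul_exp_neg_div_sqrt β
        (ha.trans_le (interior_subset hz).1)).hasDerivWithinAt)
      (fun z hz => ?_) ⟨hx, hxy⟩ ⟨hay.le, le_rfl⟩ hxy
    rw [interior_Icc] at hz
    have hz0 : 0 < z := ha.trans hz.1
    have h3 := exp_sub_affine_three_point β hz.1 hz.2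
    rw [hy] at h3
    have hk : Real.exp z - β * (1 + 2 * z) ≤ 0 := by
      by_contra! hk
      nlinarith [mul_pos (sub_pos.2 hay) hk, mul_pos (sub_pos.2 hz.2) (neg_pos.2 h)]
    exact mul_nonneg (neg_nonneg.2 hk) (by positivity)
  · refine antitoneOn_of_hasDerivWithinAt_nonpos (convex_Ici y)
      (fun z hz => (hasDerivAt_one_sub_mul_exp_neg_div_sqrt β
        (ha.trans (hay.trans_le hz))).continuousAt.continuousWithinAt)
      (fun z hz => (hasDerivAt_one_sub_mul_exp_neg_div_sqrt β
        (ha.trans (hay.trans_le (interior_subset hz)))).hasDerivWithinAt)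
      (fun z hz => ?_) (Set.mem_Ici.2 le_rfl) hxy hxy
    rw [interior_Ici] at hz
    have hyz : y < z := hz
    have hz0 : 0 < z := ha.trans (hay.trans hyz)
    have h3 := exp_sub_affine_three_point β hay hyz
    rw [hy] at h3
    have hk : 0 ≤ Real.exp z - β * (1 + 2 * z) := by
      by_contra! hk
      nlinarith [mul_pos (sub_pos.2 hay) (neg_pos.2 hk), mul_pos (sub_pos.2 hyz) (neg_pos.2 h)]
    exact mul_nonpos_of_nonpos_of_nonneg (neg_nonpos.2 hk) (by positivity)

/-- To the right of a point where it is negative, `x ↦ exp x - β * (1 + 2 * x)` has at most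
one zero. -/
theorem exp_sub_affine_zero_unique {a y z β : ℝ} (h : Real.exp a - β * (1 + 2 * a) < 0)
    (hay : a < y) (hy : Real.exp y - β * (1 + 2 * y) = 0)
    (haz : a < z) (hz : Real.exp z - β * (1 + 2 * z) = 0) : z = y := by
  rcases lt_trichotomy z y with hzy | hzy | hzy
  · have h3 := exp_sub_affine_three_point β haz hzy
    rw [hy, hz] at h3
    nlinarith [mul_pos (sub_pos.2 hzy) (neg_pos.2 h)]
  · exact hzy
  · have h3 := exp_sub_affine_three_point β hay hzy
    rw [hy, hz] at h3
    nlinarith [mul_pos (sub_pos.2 hzy) (neg_pos.2 h)]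

/-- Optimization step of the optimal-filtering method: for `β > e^{Lc}/(1+2Lc)` there is a
unique `λ̄ > L` with `β = e^{λ̄c}/(1+2λ̄c)`, and the bias function
`λ ↦ (1 − β e^{−λc})/√(λc)` attains its supremum over `[L, ∞)` at `λ̄`. -/
theorem filter_sup_attained
    (c L β : ℝ) (hc : 0 < c) (hL : 0 < L)
    (hβ : Real.exp (L * c) / (1 + 2 * L * c) < β) :
    ∃ lb : ℝ, L < lb ∧ β = Real.exp (lb * c) / (1 + 2 * lb * c) ∧
      (∀ l : ℝ, L < l → β = Real.exp (l * c) / (1 + 2 * l * c) → l = lb) ∧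
      ∀ l : ℝ, L ≤ l →
        (1 - β * Real.exp (-l * c)) / Real.sqrt (l * c) ≤
          (1 - β * Real.exp (-lb * c)) / Real.sqrt (lb * c) := by
  have hLc : 0 < L * c := mul_pos hL hc
  have hβ0 : 0 < β := lt_trans (by positivity) hβ
  have hneg : Real.exp (L * c) - β * (1 + 2 * (L * c)) < 0 := by
    rw [div_lt_iff₀ (by positivity)] at hβ
    linarith
  have hcrit (l : ℝ) (hl : L < l) : β = Real.exp (l * c) / (1 + 2 * l * c) ↔
      Real.exp (l * c) - β * (1 + 2 * (l * c)) = 0 := by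
    have hl0 : 0 < l := hL.trans hl
    rw [eq_div_iff (by positivity), sub_eq_zero, eq_comm, mul_assoc 2 l c]
  obtain ⟨y, hay, hy⟩ := exists_exp_eq_affine hLc hβ0 hneg
  obtain ⟨lb, rfl⟩ : ∃ lb, y = lb * c := ⟨y / c, (div_mul_cancel₀ y hc.ne').symm⟩
  have hlb : L < lb := lt_of_mul_lt_mul_right hay hc.le
  refine ⟨lb, hlb, (hcrit lb hlb).2 hy, fun l hl hl' => ?_, fun l hl => ?_⟩
  · exact mul_right_cancel₀ hc.ne' (exp_sub_affine_zero_unique hneg hay hy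
      (mul_lt_mul_of_pos_right hl hc) ((hcrit l hl).1 hl'))
  · rw [neg_mul, neg_mul]
    exact one_sub_mul_exp_neg_div_sqrt_le hLc hneg hay hy (mul_le_mul_of_nonneg_right hl hc.le)
end

section
/- Let n ≥ 1, let ϑ ⊆ ℝⁿ be open, T > 0, and p : ℝ → ℝ be C¹. Let z : ℝⁿ × ℝ → ℝ be C^∞ such that there is a compact set K ⊆ ϑ with supp z(·,t) ⊆ K for every t ∈ [0,T], and let φ : ℝⁿ × ℝ → ℝ be C². Set w := ∂ₜz − p(t)Δz, Gφ := ∂ₜφ + p(t)Δφ + p(t)|∇φ|², and y(t) := ∫_ϑ z(x,t)² e^{φ(x,t)} dx. Then for every t ∈ (0,T): y′(t) + 2 p(t) ∫_ϑ |∇z(x,t)|² e^{φ(x,t)} dx = ∫_ϑ Gφ(x,t) z(x,t)² e^{φ(x,t)} dx + 2 ∫_ϑ w(x,t) z(x,t) e^{φ(x,t)} dx. -/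
open MeasureTheory

/-- The Laplacian of `f : ℝⁿ → ℝ` at `x`, as the trace of the second derivative. -/
noncomputable def lapl {n : ℕ} (f : EuclideanSpace ℝ (Fin n) → ℝ)
    (x : EuclideanSpace ℝ (Fin n)) : ℝ :=
  ∑ i : Fin n, iteratedFDeriv ℝ 2 f x ![EuclideanSpace.single i 1, EuclideanSpace.single i 1]
/-- A function vanishing off a closed set has zero derivative off that set. -/
lemma fderiv_eq_zero_of_notMem_of_isClosed {E : Type*} [NormedAddCommGroup E] [NormedSpace ℝ E]
    {f : E → ℝ} {K : Set E} (hK : IsClosed K) (hf : ∀ x ∉ K, f x = 0) {x : E} (hx : x ∉ K) :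
    fderiv ℝ f x = 0 := by
  have h : f =ᶠ[nhds x] fun _ => 0 := by
    filter_upwards [hK.isOpen_compl.mem_nhds hx] with y hy using hf y hy
  rw [h.fderiv_eq]
  simp

lemma norm_gradient_sq_eq_sum {n : ℕ} (f : EuclideanSpace ℝ (Fin n) → ℝ)
    (x : EuclideanSpace ℝ (Fin n)) :
    ‖gradient f x‖ ^ 2 = ∑ i, (fderiv ℝ f x (EuclideanSpace.single i 1)) ^ 2 := by
  rw [EuclideanSpace.real_norm_sq_eq]
  refine Finset.sum_congr rfl fun i _ => ?_
  rw [← inner_gradient_left, EuclideanSpace.inner_single_right]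
  simp

lemma lapl_eq_sum_fderiv {n : ℕ} (f : EuclideanSpace ℝ (Fin n) → ℝ)
    (x : EuclideanSpace ℝ (Fin n)) :
    lapl f x = ∑ i, fderiv ℝ (fderiv ℝ f) x (EuclideanSpace.single i 1)
      (EuclideanSpace.single i 1) := by
  simp [lapl, iteratedFDeriv_two_apply]

lemma continuous_norm_gradient_sq {n : ℕ} {f : EuclideanSpace ℝ (Fin n) → ℝ}
    (hf : ContDiff ℝ 1 f) : Continuous fun x => ‖gradient f x‖ ^ 2 := by
  simp_rw [norm_gradient_sq_eq_sum]
  have := hf.continuous_fderiv one_ne_zero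
  fun_prop

lemma continuous_lapl {n : ℕ} {f : EuclideanSpace ℝ (Fin n) → ℝ}
    (hf : ContDiff ℝ 2 f) : Continuous (lapl f) := by
  have h : Continuous (fderiv ℝ (fderiv ℝ f)) :=
    (hf.fderiv_right (m := 1) (by norm_num)).continuous_fderiv one_ne_zero
  rw [funext (lapl_eq_sum_fderiv f)]
  fun_prop

/-- The derivative of a compactly supported `C¹` function integrates to zero. -/
lemma integral_fderiv_apply_eq_zero_of_hasCompactSupport {E : Type*} [NormedAddCommGroup E]
    [NormedSpace ℝ E] [FiniteDimensional ℝ E] [MeasurableSpace E] [BorelSpace E]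
    (μ : Measure E) [μ.IsAddHaarMeasure] {F : E → ℝ} (hF : ContDiff ℝ 1 F)
    (hc : HasCompactSupport F) (v : E) : ∫ x, fderiv ℝ F x v ∂μ = 0 := by
  have hcont : Continuous fun x => fderiv ℝ F x v :=
    (hF.continuous_fderiv one_ne_zero).clm_apply continuous_const
  have h := integral_mul_fderiv_eq_neg_fderiv_mul_of_integrable (μ := μ) (𝕜 := ℝ)
    (f := fun _ : E => (1 : ℝ)) (g := F) (v := v) (by simp)
    (by simpa using hcont.integrable_of_hasCompactSupport (hc.fderiv_apply ℝ v))
    (by simpa using hF.continuous.integrable_of_hasCompactSupport hc)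
    (fun _ _ => differentiableAt_const 1) (fun x _ => hF.differentiable one_ne_zero x)
  simpa using h

/-- Green's identity `∫ Δ(f²) e^g = ∫ f² Δ(e^g)`, with both Laplacians expanded. -/
lemma integral_green_sq_exp {n : ℕ} {K : Set (EuclideanSpace ℝ (Fin n))} (hK : IsCompact K)
    {f g : EuclideanSpace ℝ (Fin n) → ℝ} (hf : ContDiff ℝ 2 f) (hg : ContDiff ℝ 2 g)
    (hfK : ∀ x ∉ K, f x = 0) :
    ∫ x in K, (2 * ‖gradient f x‖ ^ 2 + 2 * (f x * lapl f x) - f x ^ 2 * lapl g x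
      - f x ^ 2 * ‖gradient g x‖ ^ 2) * Real.exp (g x) = 0 := by
  have hf' : ContDiff ℝ 1 (fderiv ℝ f) := hf.fderiv_right (by norm_num)
  have hg' : ContDiff ℝ 1 (fderiv ℝ g) := hg.fderiv_right (by norm_num)
  have hf1 : ContDiff ℝ 1 f := hf.of_le (by norm_num)
  have hg1 : ContDiff ℝ 1 g := hg.of_le (by norm_num)
  let F : EuclideanSpace ℝ (Fin n) → EuclideanSpace ℝ (Fin n) → ℝ := fun v x =>
    (2 * (f x * fderiv ℝ f x v) - f x ^ 2 * fderiv ℝ g x v) * Real.exp (g x)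
  have hF (v) : ContDiff ℝ 1 (F v) := by fun_prop
  have hFK (v) : ∀ x ∉ K, F v x = 0 := fun x hx => by simp [F, hfK x hx]
  have hderiv (v x) : fderiv ℝ (F v) x v =
      (2 * (fderiv ℝ f x v) ^ 2 + 2 * (f x * fderiv ℝ (fderiv ℝ f) x v v)
        - f x ^ 2 * fderiv ℝ (fderiv ℝ g) x v v
        - f x ^ 2 * (fderiv ℝ g x v) ^ 2) * Real.exp (g x) := by
    have df := (hf1.differentiable one_ne_zero x).hasFDerivAt
    have dg := (hg1.differentiable one_ne_zero x).hasFDerivAt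
    have df' := ((hf'.differentiable one_ne_zero x).hasFDerivAt).clm_apply (hasFDerivAt_const v x)
    have dg' := ((hg'.differentiable one_ne_zero x).hasFDerivAt).clm_apply (hasFDerivAt_const v x)
    have h := ((((df.mul df').const_mul 2).sub ((df.pow 2).mul dg')).mul dg.exp).fderiv
    have h2 : fderiv ℝ (F v) x = _ := h
    rw [h2]
    simp
    ring
  have hpt (x) : (2 * ‖gradient f x‖ ^ 2 + 2 * (f x * lapl f x) - f x ^ 2 * lapl g x
      - f x ^ 2 * ‖gradient g x‖ ^ 2) * Real.exp (g x) =
      ∑ i, fderiv ℝ (F (EuclideanSpace.single i 1)) x (EuclideanSpace.single i 1) := by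
    simp_rw [hderiv, norm_gradient_sq_eq_sum, lapl_eq_sum_fderiv, ← Finset.sum_mul,
      Finset.sum_sub_distrib, Finset.sum_add_distrib, Finset.mul_sum]
  simp_rw [hpt]
  rw [integral_finsetSum]
  · refine Finset.sum_eq_zero fun i _ => ?_
    rw [setIntegral_eq_integral_of_forall_compl_eq_zero fun x hx => by
      rw [fderiv_eq_zero_of_notMem_of_isClosed hK.isClosed (hFK _) hx]; simp]
    exact integral_fderiv_apply_eq_zero_of_hasCompactSupport volume (hF _)
      (HasCompactSupport.intro hK (hFK _)) _
  · intro i _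
    exact (((hF _).continuous_fderiv one_ne_zero).clm_apply
      continuous_const).continuousOn.integrableOn_compact hK

/-- The partial derivative in the second variable, through the total derivative. -/
lemma hasDerivAt_snd_of_contDiff {E : Type*} [NormedAddCommGroup E] [NormedSpace ℝ E]
    {g : E → ℝ → ℝ} (hg : ContDiff ℝ 1 fun q : E × ℝ => g q.1 q.2) (x : E) (t : ℝ) :
    HasDerivAt (g x) (fderiv ℝ (fun q : E × ℝ => g q.1 q.2) (x, t) (0, 1)) t := by
  have h := (hg.differentiable one_ne_zero (x, t)).hasFDerivAt
  exact h.comp_hasDerivAt t ((hasDerivAt_const t x).prodMk (hasDerivAt_id t))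

lemma continuous_deriv_snd_of_contDiff {E : Type*} [NormedAddCommGroup E] [NormedSpace ℝ E]
    {g : E → ℝ → ℝ} (hg : ContDiff ℝ 1 fun q : E × ℝ => g q.1 q.2) :
    Continuous fun q : E × ℝ => deriv (g q.1) q.2 := by
  simp_rw [fun q : E × ℝ => (hasDerivAt_snd_of_contDiff hg q.1 q.2).deriv]
  exact (hg.continuous_fderiv one_ne_zero).clm_apply continuous_const

/-- Differentiation under the integral over a compact set, for a `C¹` integrand. -/
lemma hasDerivAt_setIntegral_of_contDiff {E : Type*} [NormedAddCommGroup E] [NormedSpace ℝ E]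
    [MeasurableSpace E] [BorelSpace E] {μ : Measure E}
    [IsFiniteMeasureOnCompacts μ] {K : Set E} (hK : IsCompact K) {g : E → ℝ → ℝ}
    (hg : ContDiff ℝ 1 fun q : E × ℝ => g q.1 q.2) (t : ℝ) :
    HasDerivAt (fun s => ∫ x in K, g x s ∂μ) (∫ x in K, deriv (g x) t ∂μ) t := by
  have hd := continuous_deriv_snd_of_contDiff hg
  have hc (s) : Continuous fun x => g x s :=
    hg.continuous.comp (by fun_prop : Continuous fun x => (x, s))
  have hcd (s) : Continuous fun x => deriv (g x) s :=
    hd.comp (by fun_prop : Continuous fun x => (x, s))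
  obtain ⟨C, hC⟩ := (hK.prod (isCompact_closedBall t 1)).exists_bound_of_continuousOn
    hd.continuousOn
  refine (hasDerivAt_integral_of_dominated_loc_of_deriv_le (μ := μ.restrict K)
    (F := fun s x => g x s) (F' := fun s x => deriv (g x) s) (bound := fun _ => C)
    (Metric.closedBall_mem_nhds t one_pos) ?_ ?_ ?_ ?_ ?_ ?_).2
  · exact .of_forall fun s =>
      ((hc s).continuousOn.integrableOn_compact hK).aestronglyMeasurable
  · exact (hc t).continuousOn.integrableOn_compact hK
  · exact ((hcd t).continuousOn.integrableOn_compact hK).aestronglyMeasurable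
  · exact (ae_restrict_iff' hK.measurableSet).2 (.of_forall fun x hx s hs => hC (x, s) ⟨hx, hs⟩)
  · exact continuousOn_const.integrableOn_compact hK
  · exact .of_forall fun x s _ =>
      (hasDerivAt_snd_of_contDiff hg x s).differentiableAt.hasDerivAt

/-- First energy identity of the logarithmic convexity method (interior version of
Lemma 1(i)): for `y(t) = ∫_ϑ z² e^φ`,
`y′(t) + 2p(t)∫_ϑ |∇z|² e^φ = ∫_ϑ Gφ z² e^φ + 2∫_ϑ w z e^φ` on `(0,T)`. -/
theorem energy_identity
    (n : ℕ) (hn : 1 ≤ n) (ϑ : Set (EuclideanSpace ℝ (Fin n))) (hϑ : IsOpen ϑ)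
    (T : ℝ) (hT : 0 < T) (p : ℝ → ℝ) (hp : ContDiff ℝ 1 p)
    (z : EuclideanSpace ℝ (Fin n) → ℝ → ℝ)
    (hz : ContDiff ℝ (⊤ : ℕ∞) (fun q : EuclideanSpace ℝ (Fin n) × ℝ => z q.1 q.2))
    (K : Set (EuclideanSpace ℝ (Fin n))) (hK : IsCompact K) (hKϑ : K ⊆ ϑ)
    (hsupp : ∀ t ∈ Set.Icc (0 : ℝ) T, Function.support (fun x => z x t) ⊆ K)
    (φ : EuclideanSpace ℝ (Fin n) → ℝ → ℝ)
    (hφ : ContDiff ℝ 2 (fun q : EuclideanSpace ℝ (Fin n) × ℝ => φ q.1 q.2))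
    (w Gφ : EuclideanSpace ℝ (Fin n) → ℝ → ℝ)
    (hw : ∀ x t, w x t = deriv (z x) t - p t * lapl (fun y => z y t) x)
    (hG : ∀ x t, Gφ x t = deriv (φ x) t + p t * lapl (fun y => φ y t) x
        + p t * ‖gradient (fun y => φ y t) x‖ ^ 2)
    (y : ℝ → ℝ)
    (hy : ∀ t, y t = ∫ x in ϑ, (z x t) ^ 2 * Real.exp (φ x t)) :
    ∀ t ∈ Set.Ioo (0 : ℝ) T,
      deriv y t
          + 2 * p t * ∫ x in ϑ, ‖gradient (fun x' => z x' t) x‖ ^ 2 * Real.exp (φ x t)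
        = (∫ x in ϑ, Gφ x t * (z x t) ^ 2 * Real.exp (φ x t))
          + 2 * ∫ x in ϑ, w x t * z x t * Real.exp (φ x t) := by
  intro t ht
  have hzero : ∀ s ∈ Set.Icc (0 : ℝ) T, ∀ x ∉ K, z x s = 0 := fun s hs x hx => by
    by_contra h
    exact hx (hsupp s hs h)
  have hzK := hzero t ⟨ht.1.le, ht.2.le⟩
  have hϑK {f : EuclideanSpace ℝ (Fin n) → ℝ} (hf : ∀ x ∉ K, f x = 0) :
      ∫ x in ϑ, f x = ∫ x in K, f x :=
    setIntegral_eq_of_subset_of_forall_sdiff_eq_zero hϑ.measurableSet hKϑ fun x hx => hf x hx.2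
  have hz2 : ContDiff ℝ 2 fun q : EuclideanSpace ℝ (Fin n) × ℝ => z q.1 q.2 :=
    hz.of_le (WithTop.coe_le_coe.2 (le_top : (2 : ℕ∞) ≤ ⊤))
  have hz1 : ContDiff ℝ 1 fun q : EuclideanSpace ℝ (Fin n) × ℝ => z q.1 q.2 :=
    hz2.of_le (by norm_num)
  have hφ1 : ContDiff ℝ 1 fun q : EuclideanSpace ℝ (Fin n) × ℝ => φ q.1 q.2 :=
    hφ.of_le (by norm_num)
  have hslice : ContDiff ℝ 2 fun x : EuclideanSpace ℝ (Fin n) => (x, t) := by fun_prop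
  have hzt : ContDiff ℝ 2 fun x => z x t := hz2.comp hslice
  have hφt : ContDiff ℝ 2 fun x => φ x t := hφ.comp hslice
  have hy' : deriv y t = ∫ x in K,
      (2 * z x t * deriv (z x) t + z x t ^ 2 * deriv (φ x) t) * Real.exp (φ x t) := by
    have hyK : y =ᶠ[nhds t] fun s => ∫ x in K, z x s ^ 2 * Real.exp (φ x s) := by
      filter_upwards [Icc_mem_nhds ht.1 ht.2] with s hs
      rw [hy, hϑK fun x hx => by simp [hzero s hs x hx]]
    have hg : ContDiff ℝ 1 fun q : EuclideanSpace ℝ (Fin n) × ℝ =>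
        z q.1 q.2 ^ 2 * Real.exp (φ q.1 q.2) := by fun_prop
    rw [hyK.deriv_eq, (hasDerivAt_setIntegral_of_contDiff hK
      (g := fun x s => z x s ^ 2 * Real.exp (φ x s)) hg t).deriv]
    congr 1 with x
    have dz := (hasDerivAt_snd_of_contDiff hz1 x t).differentiableAt.hasDerivAt
    have dφ := (hasDerivAt_snd_of_contDiff hφ1 x t).differentiableAt.hasDerivAt
    refine ((dz.pow 2).mul dφ.exp).deriv.trans ?_
    simp
    ring
  have cz := hzt.continuous
  have cφ := hφt.continuous
  have cdz : Continuous fun x => deriv (z x) t :=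
    (continuous_deriv_snd_of_contDiff hz1).comp hslice.continuous
  have cdφ : Continuous fun x => deriv (φ x) t :=
    (continuous_deriv_snd_of_contDiff hφ1).comp hslice.continuous
  have clz := continuous_lapl hzt
  have clφ := continuous_lapl hφt
  have cgz := continuous_norm_gradient_sq (hzt.of_le (by norm_num : (1 : WithTop ℕ∞) ≤ 2))
  have cgφ := continuous_norm_gradient_sq (hφt.of_le (by norm_num : (1 : WithTop ℕ∞) ≤ 2))
  have hint {f : EuclideanSpace ℝ (Fin n) → ℝ} (hf : Continuous f) : IntegrableOn f K :=
    hf.continuousOn.integrableOn_compact hK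
  have hgrad : ∀ x ∉ K, ‖gradient (fun x' => z x' t) x‖ ^ 2 * Real.exp (φ x t) = 0 :=
    fun x hx => by
      simp [gradient, fderiv_eq_zero_of_notMem_of_isClosed hK.isClosed hzK hx]
  rw [hy', hϑK hgrad, hϑK fun x hx => by simp [hzK x hx], hϑK fun x hx => by simp [hzK x hx]]
  have hgreen := integral_green_sq_exp hK hzt hφt hzK
  simp_rw [hw, hG]
  have e := congrArg (p t * ·) hgreen
  simp only [mul_zero, ← integral_const_mul] at e ⊢
  rw [← sub_eq_zero, ← integral_add (hint (by fun_prop)) (hint (by fun_prop)),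
    ← integral_add (hint (by fun_prop)) (hint (by fun_prop)),
    ← integral_sub (hint (by fun_prop)) (hint (by fun_prop)), ← e]
  congr 1 with x
  ring
end

section
/- Let n ≥ 1, x₀ ∈ ℝⁿ, T > 0, ρ > 0, R > 0, and let p : ℝ → ℝ be C¹ with 0 < p₁ ≤ p(t) ≤ p₂ and |p′(t)| ≤ M for all t ∈ [0,T]. Define φ(x,t) := −|x − x₀|²/(4p(T)(T − t + ρ)) − (n/2) ln(T − t + ρ). Then for every t ∈ [0,T] and every x with |x − x₀| ≤ R: | ∂ₜφ(x,t) + p(t) Δφ(x,t) + p(t) |∇φ(x,t)|² | ≤ nM/(2p₁) + (M R²/(4p₁²)) · 1/(T − t + ρ). -/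
theorem hasGradientAt_mul_norm_sub_sq_add {F : Type*} [NormedAddCommGroup F]
    [InnerProductSpace ℝ F] [CompleteSpace F] (a b : ℝ) (x₀ x : F) :
    HasGradientAt (fun y => a * ‖y - x₀‖ ^ 2 + b) ((2 * a) • (x - x₀)) x := by
  rw [hasGradientAt_iff_hasFDerivAt]
  have h := ((((hasFDerivAt_id x).sub_const x₀).norm_sq).const_mul a).add_const b
  refine h.congr_fderiv ?_
  ext v
  simp
  ring

theorem lapl_mul_norm_sub_sq_add {n : ℕ} (a b : ℝ) (x₀ x : EuclideanSpace ℝ (Fin n)) :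
    lapl (fun y => a * ‖y - x₀‖ ^ 2 + b) x = 2 * a * n := by
  have hf : fderiv ℝ (fun y : EuclideanSpace ℝ (Fin n) => a * ‖y - x₀‖ ^ 2 + b) =
      fun y => (2 * a) • innerSL ℝ (y - x₀) := by
    ext y v
    rw [(hasGradientAt_mul_norm_sub_sq_add a b x₀ y).fderiv_apply]
    simp [inner_smul_left, inner_sub_left]
  have hg : HasFDerivAt
      (fun y : EuclideanSpace ℝ (Fin n) => (2 * a) • innerSL ℝ (y - x₀))
      ((2 * a) • innerSL ℝ) x :=
    ((innerSL ℝ).hasFDerivAt.comp x ((hasFDerivAt_id x).sub_const x₀)).const_smul (2 * a)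
  simp only [lapl, iteratedFDeriv_two_apply, hf, hg.fderiv]
  simp [innerSL_apply_apply ℝ]
  ring

theorem hasDerivAt_backward_weight (c d T ρ t : ℝ) (ht : T - t + ρ ≠ 0) :
    HasDerivAt (fun τ => c / (T - τ + ρ) - d * Real.log (T - τ + ρ))
      (c / (T - t + ρ) ^ 2 + d / (T - t + ρ)) t := by
  have hs : HasDerivAt (fun τ => T - τ + ρ) (-1) t :=
    ((hasDerivAt_id t).const_sub T).add_const ρ
  have h := ((hasDerivAt_const t c).div hs ht).sub ((hs.log ht).const_mul d)
  refine h.congr_deriv ?_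
  field_simp
  ring

theorem abs_sub_le_mul_of_abs_deriv_le {p : ℝ → ℝ} (hp : Differentiable ℝ p) {a b M : ℝ}
    (hM : ∀ t ∈ Set.Icc a b, |deriv p t| ≤ M) {t : ℝ} (ht : t ∈ Set.Icc a b) :
    |p b - p t| ≤ M * (b - t) := by
  have h := (convex_Icc a b).norm_image_sub_le_of_norm_deriv_le
    (fun y _ => hp y) hM ht ⟨ht.1.trans ht.2, le_rfl⟩
  simpa [abs_of_nonneg (sub_nonneg.2 ht.2)] using h

/-- Estimate on `Gφ = ∂ₜφ + p(t)Δφ + p(t)|∇φ|²` for the backward heat-kernel weight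
built with the value `p(T)`:
`|Gφ| ≤ nM/(2p₁) + (MR²/(4p₁²))·1/(T−t+ρ)` on `|x−x₀| ≤ R`, `t ∈ [0,T]`. -/
theorem weight_G_estimate
    (n : ℕ) (hn : 1 ≤ n) (x₀ : EuclideanSpace ℝ (Fin n))
    (T ρ R p₁ p₂ M : ℝ) (hT : 0 < T) (hρ : 0 < ρ) (hR : 0 < R)
    (p : ℝ → ℝ) (hp : ContDiff ℝ 1 p)
    (hp₁ : 0 < p₁) (hpbd : ∀ t ∈ Set.Icc (0 : ℝ) T, p₁ ≤ p t ∧ p t ≤ p₂)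
    (hp' : ∀ t ∈ Set.Icc (0 : ℝ) T, |deriv p t| ≤ M)
    (φ : EuclideanSpace ℝ (Fin n) → ℝ → ℝ)
    (hφ : ∀ x t, φ x t =
      -‖x - x₀‖ ^ 2 / (4 * p T * (T - t + ρ)) - (n / 2 : ℝ) * Real.log (T - t + ρ)) :
    ∀ t ∈ Set.Icc (0 : ℝ) T, ∀ x : EuclideanSpace ℝ (Fin n), ‖x - x₀‖ ≤ R →
      |deriv (φ x) t + p t * lapl (fun y => φ y t) x
          + p t * ‖gradient (fun y => φ y t) x‖ ^ 2| ≤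
        (n : ℝ) * M / (2 * p₁) + (M * R ^ 2 / (4 * p₁ ^ 2)) * (1 / (T - t + ρ)) := by
  intro t ht x hx
  have hs : 0 < T - t + ρ := by linarith [ht.2]
  have hT' : T ∈ Set.Icc (0 : ℝ) T := ⟨hT.le, le_rfl⟩
  have hP₁ : p₁ ≤ p T := (hpbd T hT').1
  have hP : 0 < p T := hp₁.trans_le hP₁
  have hM : 0 ≤ M := (abs_nonneg _).trans (hp' T hT')
  have hdiff : |p T - p t| ≤ M * (T - t + ρ) :=
    (abs_sub_le_mul_of_abs_deriv_le (hp.differentiable one_ne_zero) hp' ht).trans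
      (mul_le_mul_of_nonneg_left (by linarith) hM)
  have hspace : (fun y => φ y t) = fun y =>
      (-1 / (4 * p T * (T - t + ρ))) * ‖y - x₀‖ ^ 2 + -((n / 2 : ℝ) * Real.log (T - t + ρ)) := by
    funext y
    rw [hφ]
    ring
  have htime : φ x = fun τ => (-‖x - x₀‖ ^ 2 / (4 * p T)) / (T - τ + ρ)
      - (n / 2 : ℝ) * Real.log (T - τ + ρ) := by
    funext τ
    rw [hφ, div_div]
  rw [hspace, lapl_mul_norm_sub_sq_add, (hasGradientAt_mul_norm_sub_sq_add _ _ x₀ x).gradient,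
    htime, (hasDerivAt_backward_weight _ _ T ρ t hs.ne').deriv, norm_smul, mul_pow,
    Real.norm_eq_abs, sq_abs]
  set s := T - t + ρ
  set r := ‖x - x₀‖
  have hr : 0 ≤ r := norm_nonneg _
  have hfactor : -r ^ 2 / (4 * p T) / s ^ 2 + (n / 2 : ℝ) / s
      + p t * (2 * (-1 / (4 * p T * s)) * n)
      + p t * ((2 * (-1 / (4 * p T * s))) ^ 2 * r ^ 2)
      = (p T - p t) * ((n / (2 * p T * s)) - r ^ 2 / (4 * p T ^ 2 * s ^ 2)) := by
    field_simp
    ring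
  have hbracket : |n / (2 * p T * s) - r ^ 2 / (4 * p T ^ 2 * s ^ 2)| ≤
      n / (2 * p₁ * s) + R ^ 2 / (4 * p₁ ^ 2 * s ^ 2) := by
    refine (abs_sub _ _).trans ?_
    rw [abs_of_nonneg (by positivity), abs_of_nonneg (by positivity)]
    gcongr
  rw [hfactor, abs_mul]
  calc |p T - p t| * |n / (2 * p T * s) - r ^ 2 / (4 * p T ^ 2 * s ^ 2)|
      ≤ (M * s) * (n / (2 * p₁ * s) + R ^ 2 / (4 * p₁ ^ 2 * s ^ 2)) :=
        mul_le_mul hdiff hbracket (abs_nonneg _) (by positivity)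
    _ = n * M / (2 * p₁) + (M * R ^ 2 / (4 * p₁ ^ 2)) * (1 / s) := by
        field_simp
end

section
/- Let n ≥ 1, x₀ ∈ ℝⁿ, R > 0, T > 0, ρ > 0, and let ϑ ⊆ ℝⁿ be open with ϑ ⊆ B(x₀,R). Let p : ℝ → ℝ be C¹ with 0 < p₁ ≤ p(t) ≤ p₂ and |p′(t)| ≤ M on [0,T]. Define φ(x,t) := −|x − x₀|²/(4p(T)(T − t + ρ)) − (n/2) ln(T − t + ρ). Let z : ℝⁿ × ℝ → ℝ be C^∞ with supp z(·,t) contained in a fixed compact K ⊆ ϑ for all t ∈ [0,T]; set w := ∂ₜz − p(t)Δz, y(t) := ∫_ϑ z² e^{φ} dx, assume y > 0 on [0,T], and set N(t) := p(t) ∫_ϑ |∇z|² e^{φ} dx / y(t). Then for every t ∈ (0,T): N′(t) ≤ ( (1 + C₀)/(T − t + ρ) + C₁ ) N(t) + (1/(2y(t))) ∫_ϑ w² e^{φ} dx, where C₀ := M R²/(2p₁²) and C₁ := (2+n) M/p₁. -/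
open MeasureTheory

/-- The `i`-th partial derivative of `f : ℝⁿ → ℝ` at `x`. -/
noncomputable def partialDeriv {n : ℕ} (i : Fin n) (f : EuclideanSpace ℝ (Fin n) → ℝ)
    (x : EuclideanSpace ℝ (Fin n)) : ℝ :=
  fderiv ℝ f x (EuclideanSpace.single i 1)

section Spatial

variable {n : ℕ}

lemma ContDiff.partialDeriv {k m : WithTop ℕ∞} {f : EuclideanSpace ℝ (Fin n) → ℝ}
    (hf : ContDiff ℝ m f) (hk : k + 1 ≤ m) (i : Fin n) : ContDiff ℝ k (partialDeriv i f) :=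
  (hf.fderiv_right hk).clm_apply contDiff_const

lemma hasLineDerivAt_partialDeriv {f : EuclideanSpace ℝ (Fin n) → ℝ} (hf : ContDiff ℝ 1 f)
    (i : Fin n) (x : EuclideanSpace ℝ (Fin n)) :
    HasLineDerivAt ℝ f (partialDeriv i f x) x (EuclideanSpace.single i 1) :=
  (hf.differentiable (by norm_num) x).hasFDerivAt.hasLineDerivAt _

lemma partialDeriv_comm {f : EuclideanSpace ℝ (Fin n) → ℝ} (hf : ContDiff ℝ 2 f)
    (i j : Fin n) (x : EuclideanSpace ℝ (Fin n)) :
    partialDeriv i (partialDeriv j f) x = partialDeriv j (partialDeriv i f) x := by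
  have hd : DifferentiableAt ℝ (fderiv ℝ f) x :=
    (hf.fderiv_right (m := 1) (by norm_num)).differentiable (by norm_num) x
  have key : ∀ i j : Fin n, partialDeriv i (partialDeriv j f) x
      = fderiv ℝ (fderiv ℝ f) x (EuclideanSpace.single i 1) (EuclideanSpace.single j 1) := by
    intro i j
    change fderiv ℝ (fun y => fderiv ℝ f y (EuclideanSpace.single j 1)) x _ = _
    rw [fderiv_clm_apply hd (by fun_prop)]
    simp
  rw [key, key]
  exact (hf.contDiffAt.isSymmSndFDerivAt (by simp)) _ _

lemma lapl_eq_sum_partialDeriv {f : EuclideanSpace ℝ (Fin n) → ℝ} (hf : ContDiff ℝ 2 f)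
    (x : EuclideanSpace ℝ (Fin n)) :
    lapl f x = ∑ i, partialDeriv i (partialDeriv i f) x := by
  have hd : DifferentiableAt ℝ (fderiv ℝ f) x :=
    (hf.fderiv_right (m := 1) (by norm_num)).differentiable (by norm_num) x
  refine Finset.sum_congr rfl fun i _ => ?_
  rw [iteratedFDeriv_two_apply]
  change _ = fderiv ℝ (fun y => fderiv ℝ f y (EuclideanSpace.single i 1)) x _
  rw [fderiv_clm_apply hd (by fun_prop)]
  simp

lemma norm_gradient_sq (f : EuclideanSpace ℝ (Fin n) → ℝ) (x : EuclideanSpace ℝ (Fin n)) :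
    ‖gradient f x‖ ^ 2 = ∑ i, partialDeriv i f x ^ 2 := by
  rw [EuclideanSpace.real_norm_sq_eq]
  refine Finset.sum_congr rfl fun i _ => ?_
  have : partialDeriv i f x = inner ℝ (gradient f x) (EuclideanSpace.single i 1) := by
    simp only [partialDeriv, gradient, InnerProductSpace.toDual_symm_apply]
  rw [this, EuclideanSpace.inner_single_right]
  simp

lemma partialDeriv_eq_zero_of_notMem {K : Set (EuclideanSpace ℝ (Fin n))} (hK : IsClosed K)
    {f : EuclideanSpace ℝ (Fin n) → ℝ} (hf : ∀ x ∉ K, f x = 0) (i : Fin n) :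
    ∀ x ∉ K, partialDeriv i f x = 0 := by
  intro x hx
  have : f =ᶠ[nhds x] fun _ => 0 := by
    filter_upwards [hK.isOpen_compl.mem_nhds hx] with y hy using hf y hy
  simp [partialDeriv, this.fderiv_eq]

lemma Continuous.integrable_of_eq_zero_off {K : Set (EuclideanSpace ℝ (Fin n))} (hK : IsCompact K)
    {f : EuclideanSpace ℝ (Fin n) → ℝ} (hf : Continuous f) (hf0 : ∀ x ∉ K, f x = 0) :
    Integrable f :=
  hf.integrable_of_hasCompactSupport (HasCompactSupport.intro hK hf0)

/-- The divergence theorem for compactly supported vector fields. -/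
lemma integral_divergence_eq_zero {K : Set (EuclideanSpace ℝ (Fin n))} (hK : IsCompact K)
    {F F' : Fin n → EuclideanSpace ℝ (Fin n) → ℝ}
    (hd : ∀ i x, HasLineDerivAt ℝ (F i) (F' i x) x (EuclideanSpace.single i 1))
    (hF : ∀ i, Continuous (F i)) (hF' : ∀ i, Continuous (F' i))
    (hF0 : ∀ i, ∀ x ∉ K, F i x = 0) (hF'0 : ∀ i, ∀ x ∉ K, F' i x = 0) :
    ∫ x, ∑ i, F' i x = 0 := by
  have hint i := (hF' i).integrable_of_eq_zero_off hK (hF'0 i)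
  rw [integral_finsetSum _ fun i _ => hint i]
  refine Finset.sum_eq_zero fun i _ => ?_
  have := integral_bilinear_hasLineDerivAt_right_eq_neg_left_of_integrable
    (μ := (volume : Measure (EuclideanSpace ℝ (Fin n))))
    (f := fun _ => (1 : ℝ)) (f' := fun _ => 0) (g := F i) (g' := F' i)
    (v := EuclideanSpace.single i 1) (B := ContinuousLinearMap.mul ℝ ℝ)
    (by simp) (by simpa using hint i)
    (by simpa using (hF i).integrable_of_eq_zero_off hK (hF0 i))
    (fun x _ => by simpa [HasLineDerivAt] using hasDerivAt_const (0 : ℝ) (1 : ℝ))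
    (fun x _ => hd i x)
  simpa using this

variable {K : Set (EuclideanSpace ℝ (Fin n))} {x₀ : EuclideanSpace ℝ (Fin n)} {c : ℝ}
  {m : EuclideanSpace ℝ (Fin n) → ℝ}

lemma hasLineDerivAt_sub_coord (i j : Fin n) (x x₀ : EuclideanSpace ℝ (Fin n)) :
    HasLineDerivAt ℝ (fun y => y j - x₀ j) (if j = i then 1 else 0) x
      (EuclideanSpace.single i 1) := by
  unfold HasLineDerivAt
  have h := (((hasDerivAt_id (0 : ℝ)).mul_const ((EuclideanSpace.single i (1 : ℝ)) j)).const_add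
    (x j)).sub_const (x₀ j)
  simpa [Pi.single_apply] using h

/-- Green's identity with respect to a weight `m` with `∇m = -c (x - x₀) m`. -/
lemma integral_weighted_green (hK : IsCompact K) (hm : Continuous m)
    (hdm : ∀ i x, HasLineDerivAt ℝ m (-c * (x i - x₀ i) * m x) x (EuclideanSpace.single i 1))
    {a b : EuclideanSpace ℝ (Fin n) → ℝ} (ha : ContDiff ℝ 2 a) (hb : ContDiff ℝ 1 b)
    (ha0 : ∀ x ∉ K, a x = 0) :
    ∫ x, ((∑ i, partialDeriv i b x * partialDeriv i a x)
      + b x * ((∑ i, partialDeriv i (partialDeriv i a) x)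
        + ∑ i, -c * (x i - x₀ i) * partialDeriv i a x)) * m x = 0 := by
  have ha1 i : ContDiff ℝ 1 (partialDeriv i a) := ha.partialDeriv (by norm_num) i
  have ha2 i j : Continuous (partialDeriv i (partialDeriv j a)) :=
    ((ha1 j).partialDeriv (k := 0) (by norm_num) i).continuous
  have hb1 i : Continuous (partialDeriv i b) :=
    (hb.partialDeriv (k := 0) (by norm_num) i).continuous
  have ha10 i := partialDeriv_eq_zero_of_notMem hK.isClosed ha0 i
  have ha20 i j := partialDeriv_eq_zero_of_notMem hK.isClosed (ha10 j) i
  have ha1c i := (ha1 i).continuous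
  have hbc := hb.continuous
  rw [← integral_divergence_eq_zero hK
    (F := fun i x => b x * partialDeriv i a x * m x)
    (F' := fun i x => (partialDeriv i b x * partialDeriv i a x
      + b x * partialDeriv i (partialDeriv i a) x) * m x
      + b x * partialDeriv i a x * (-c * (x i - x₀ i) * m x))]
  · congr 1
    ext x
    simp only [Finset.mul_sum, Finset.sum_mul, mul_add, add_mul, Finset.sum_add_distrib]
    have : ∀ i, b x * (-c * (x i - x₀ i) * partialDeriv i a x) * m x
      = b x * partialDeriv i a x * (-c * (x i - x₀ i) * m x) := fun i => by ring
    simp only [this]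
    ring
  · intro i x
    have h1 := hasLineDerivAt_partialDeriv hb i x
    have h2 := hasLineDerivAt_partialDeriv (ha1 i) i x
    have h3 := hdm i x
    unfold HasLineDerivAt at h1 h2 h3 ⊢
    refine HasDerivAt.congr_deriv ((h1.mul h2).mul h3) ?_
    simp
  · intro i; fun_prop
  · intro i; fun_prop
  · intro i x hx; simp [ha10 i x hx]
  · intro i x hx; simp [ha10 i x hx, ha20 i i x hx]

/-- `∫ a² Δm` integrated by parts, for a weight `m` with `∇m = -c (x - x₀) m`. -/
lemma integral_weighted_sq_drift (hK : IsCompact K) (hm : Continuous m)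
    (hdm : ∀ i x, HasLineDerivAt ℝ m (-c * (x i - x₀ i) * m x) x (EuclideanSpace.single i 1))
    {a : EuclideanSpace ℝ (Fin n) → ℝ} (ha : ContDiff ℝ 1 a) (ha0 : ∀ x ∉ K, a x = 0) :
    ∫ x, (2 * a x * (∑ i, -c * (x i - x₀ i) * partialDeriv i a x)
      - a x ^ 2 * (n * c - c ^ 2 * ‖x - x₀‖ ^ 2)) * m x = 0 := by
  have ha1 i : Continuous (partialDeriv i a) :=
    (ha.partialDeriv (k := 0) (by norm_num) i).continuous
  have ha10 i := partialDeriv_eq_zero_of_notMem hK.isClosed ha0 i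
  have hac := ha.continuous
  rw [← integral_divergence_eq_zero hK
    (F := fun i x => a x * a x * (-c * (x i - x₀ i)) * m x)
    (F' := fun i x => ((partialDeriv i a x * a x + a x * partialDeriv i a x) * (-c * (x i - x₀ i))
      + a x * a x * -c) * m x
      + a x * a x * (-c * (x i - x₀ i)) * (-c * (x i - x₀ i) * m x))]
  · congr 1
    ext x
    rw [EuclideanSpace.real_norm_sq_eq]
    have hn : (n : ℝ) * c = ∑ _i : Fin n, c := by simp
    rw [hn]
    simp only [Finset.mul_sum, ← Finset.sum_sub_distrib, Finset.sum_mul]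
    refine Finset.sum_congr rfl fun i _ => ?_
    simp only [PiLp.sub_apply]
    ring
  · intro i x
    have h1 := hasLineDerivAt_partialDeriv ha i x
    have h2 := hasLineDerivAt_sub_coord i i x x₀
    have h3 := hdm i x
    unfold HasLineDerivAt at h1 h2 h3 ⊢
    refine HasDerivAt.congr_deriv (((h1.mul h1).mul (h2.const_mul (-c))).mul h3) ?_
    simp
  · intro i; fun_prop
  · intro i; fun_prop
  · intro i x hx; simp [ha0 x hx]
  · intro i x hx; simp [ha0 x hx]

/-- The Rellich–Pohozaev identity with respect to a weight `m` with `∇m = -c (x - x₀) m`. -/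
lemma integral_weighted_rellich (hK : IsCompact K) (hm : Continuous m)
    (hdm : ∀ i x, HasLineDerivAt ℝ m (-c * (x i - x₀ i) * m x) x (EuclideanSpace.single i 1))
    {a : EuclideanSpace ℝ (Fin n) → ℝ} (ha : ContDiff ℝ 2 a) (ha0 : ∀ x ∉ K, a x = 0) :
    ∫ x, (2 * (∑ i, -c * (x i - x₀ i) * partialDeriv i a x)
        * ((∑ i, partialDeriv i (partialDeriv i a) x)
          + ∑ i, -c * (x i - x₀ i) * partialDeriv i a x)
      - 2 * c * (∑ i, partialDeriv i a x ^ 2)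
      + (∑ i, partialDeriv i a x ^ 2) * (n * c - c ^ 2 * ‖x - x₀‖ ^ 2)) * m x = 0 := by
  have ha1 i : ContDiff ℝ 1 (partialDeriv i a) := ha.partialDeriv (by norm_num) i
  have ha2 i j : Continuous (partialDeriv i (partialDeriv j a)) :=
    ((ha1 j).partialDeriv (k := 0) (by norm_num) i).continuous
  have ha10 i := partialDeriv_eq_zero_of_notMem hK.isClosed ha0 i
  have ha20 i j := partialDeriv_eq_zero_of_notMem hK.isClosed (ha10 j) i
  have ha1c i := (ha1 i).continuous
  rw [← integral_divergence_eq_zero hK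
    (F := fun i x => (2 * (∑ j, -c * (x j - x₀ j) * partialDeriv j a x) * partialDeriv i a x
      + c * (x i - x₀ i) * ∑ j, partialDeriv j a x * partialDeriv j a x) * m x)
    (F' := fun i x => (2 * (∑ j, (-c * (if j = i then 1 else 0) * partialDeriv j a x
        + -c * (x j - x₀ j) * partialDeriv i (partialDeriv j a) x)) * partialDeriv i a x
      + 2 * (∑ j, -c * (x j - x₀ j) * partialDeriv j a x) * partialDeriv i (partialDeriv i a) x
      + (c * 1 * (∑ j, partialDeriv j a x * partialDeriv j a x)
      + c * (x i - x₀ i) * ∑ j, (partialDeriv i (partialDeriv j a) x * partialDeriv j a x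
        + partialDeriv j a x * partialDeriv i (partialDeriv j a) x))) * m x
      + (2 * (∑ j, -c * (x j - x₀ j) * partialDeriv j a x) * partialDeriv i a x
      + c * (x i - x₀ i) * ∑ j, partialDeriv j a x * partialDeriv j a x)
        * (-c * (x i - x₀ i) * m x))]
  · congr 1
    ext x
    rw [EuclideanSpace.real_norm_sq_eq]
    simp only [PiLp.sub_apply]
    set H := ∑ j, -c * (x j - x₀ j) * partialDeriv j a x with hH
    set G := ∑ j, partialDeriv j a x * partialDeriv j a x with hG
    have hG2 : ∑ j, partialDeriv j a x ^ 2 = G := by simp [hG, sq]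
    have hcross : ∑ i, (∑ j, -c * (x j - x₀ j) * partialDeriv i (partialDeriv j a) x)
          * partialDeriv i a x
        = ∑ i, -c * (x i - x₀ i) *
          ∑ j, partialDeriv i (partialDeriv j a) x * partialDeriv j a x := by
      simp only [Finset.sum_mul, Finset.mul_sum]
      rw [Finset.sum_comm]
      refine Finset.sum_congr rfl fun i _ => Finset.sum_congr rfl fun j _ => ?_
      rw [partialDeriv_comm ha j i x]
      ring
    have hterm : ∀ i, (2 * (∑ j, (-c * (if j = i then 1 else 0) * partialDeriv j a x
        + -c * (x j - x₀ j) * partialDeriv i (partialDeriv j a) x)) * partialDeriv i a x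
      + 2 * H * partialDeriv i (partialDeriv i a) x
      + (c * 1 * G
      + c * (x i - x₀ i) * ∑ j, (partialDeriv i (partialDeriv j a) x * partialDeriv j a x
        + partialDeriv j a x * partialDeriv i (partialDeriv j a) x))) * m x
      + (2 * H * partialDeriv i a x + c * (x i - x₀ i) * G) * (-c * (x i - x₀ i) * m x)
      = -2 * c * m x * (partialDeriv i a x * partialDeriv i a x)
        + 2 * m x * ((∑ j, -c * (x j - x₀ j) * partialDeriv i (partialDeriv j a) x)
          * partialDeriv i a x)
        + 2 * H * m x * partialDeriv i (partialDeriv i a) x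
        + c * G * m x
        - 2 * m x * (-c * (x i - x₀ i) *
          ∑ j, partialDeriv i (partialDeriv j a) x * partialDeriv j a x)
        + 2 * H * m x * (-c * (x i - x₀ i) * partialDeriv i a x)
        - c ^ 2 * G * m x * (x i - x₀ i) ^ 2 := by
      intro i
      have e1 : ∑ j, (-c * (if j = i then 1 else 0) * partialDeriv j a x
        + -c * (x j - x₀ j) * partialDeriv i (partialDeriv j a) x)
        = -c * partialDeriv i a x
          + ∑ j, -c * (x j - x₀ j) * partialDeriv i (partialDeriv j a) x := by
        rw [Finset.sum_add_distrib]; simp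
      have e2 : ∑ j, (partialDeriv i (partialDeriv j a) x * partialDeriv j a x
        + partialDeriv j a x * partialDeriv i (partialDeriv j a) x)
        = 2 * ∑ j, partialDeriv i (partialDeriv j a) x * partialDeriv j a x := by
        rw [Finset.mul_sum]; exact Finset.sum_congr rfl fun j _ => by ring
      rw [e1, e2]; ring
    rw [Finset.sum_congr rfl fun i _ => hterm i]
    simp only [Finset.sum_add_distrib, Finset.sum_sub_distrib, ← Finset.mul_sum]
    rw [hcross, ← hG, ← hH, hG2]
    simp only [Finset.sum_const, Finset.card_univ, Fintype.card_fin, nsmul_eq_mul]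
    ring
  · intro i x
    have h1 j := hasLineDerivAt_partialDeriv (ha1 j) i x
    have h2 j := hasLineDerivAt_sub_coord i j x x₀
    have h3 := hdm i x
    unfold HasLineDerivAt at h1 h2 h3 ⊢
    have hA := HasDerivAt.fun_sum (u := Finset.univ)
      fun j _ => ((h2 j).const_mul (-c)).mul (h1 j)
    have hB := HasDerivAt.fun_sum (u := Finset.univ) fun j _ => (h1 j).mul (h1 j)
    refine HasDerivAt.congr_deriv (((((hA.const_mul 2).mul (h1 i)).add
      (((h2 i).const_mul c).mul hB)).mul h3)) ?_
    simp
  · intro i; fun_prop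
  · intro i; fun_prop
  · intro i x hx; simp [fun j => ha10 j x hx]
  · intro i x hx; simp [fun j => ha10 j x hx, fun j => ha20 i j x hx]

end Spatial

section Energy

variable {n : ℕ} {K : Set (EuclideanSpace ℝ (Fin n))} {x₀ : EuclideanSpace ℝ (Fin n)} {c : ℝ}
  {m : EuclideanSpace ℝ (Fin n) → ℝ}

lemma integral_sum_mul_weight (hK : IsCompact K) (hm : Continuous m) {k : ℕ} (r : Fin k → ℝ)
    (f : Fin k → EuclideanSpace ℝ (Fin n) → ℝ) (hf : ∀ i, Continuous (f i))
    (hf0 : ∀ i, ∀ x ∉ K, f i x = 0) :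
    ∫ x, (∑ i, r i * f i x) * m x = ∑ i, r i * ∫ x, f i x * m x := by
  simp only [Finset.sum_mul, mul_assoc]
  rw [integral_finsetSum]
  · simp only [integral_const_mul]
  · intro i _
    exact (((hf i).mul hm).integrable_of_eq_zero_off hK
      fun x hx => by simp [hf0 i x hx]).const_mul _

lemma abs_integral_mul_potential_le (hK : IsCompact K) (hm : Continuous m) (hm0 : ∀ x, 0 ≤ m x)
    {R : ℝ} (hKR : ∀ x ∈ K, ‖x - x₀‖ ≤ R) (hc : 0 ≤ c)
    {f : EuclideanSpace ℝ (Fin n) → ℝ} (hf : Continuous f) (hf_nonneg : ∀ x, 0 ≤ f x)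
    (hf0 : ∀ x ∉ K, f x = 0) :
    |∫ x, f x * (n * c - c ^ 2 * ‖x - x₀‖ ^ 2) * m x|
      ≤ (n * c + c ^ 2 * R ^ 2) * ∫ x, f x * m x := by
  rw [← integral_const_mul]
  refine (abs_integral_le_integral_abs).trans (integral_mono ?_ ?_ fun x => ?_)
  · refine (Continuous.integrable_of_eq_zero_off hK (by fun_prop) fun x hx => ?_).abs
    simp [hf0 x hx]
  · refine (Continuous.integrable_of_eq_zero_off hK (by fun_prop) fun x hx => ?_).const_mul _
    simp [hf0 x hx]
  · by_cases hx : x ∈ K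
    · have h1 : ‖x - x₀‖ ^ 2 ≤ R ^ 2 := pow_le_pow_left₀ (norm_nonneg _) (hKR x hx) 2
      have h2 : |n * c - c ^ 2 * ‖x - x₀‖ ^ 2| ≤ n * c + c ^ 2 * R ^ 2 := by
        have h3 : c ^ 2 * ‖x - x₀‖ ^ 2 ≤ c ^ 2 * R ^ 2 := by gcongr
        have h4 : 0 ≤ c ^ 2 * ‖x - x₀‖ ^ 2 := by positivity
        have h5 : 0 ≤ (n : ℝ) * c := by positivity
        rw [abs_le]; constructor <;> linarith
      have h3 := mul_le_mul_of_nonneg_right h2 (mul_nonneg (hf_nonneg x) (hm0 x))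
      simp only [abs_mul, abs_of_nonneg (hf_nonneg x), abs_of_nonneg (hm0 x)]
      linarith
    · simp [hf0 x hx]

variable {a b : EuclideanSpace ℝ (Fin n) → ℝ}

/-- The derivative of `∫ a² m`, where `b` is the time derivative of `a`. -/
lemma integral_weighted_mass_rate (hK : IsCompact K) (hm : Continuous m)
    (hdm : ∀ i x, HasLineDerivAt ℝ m (-c * (x i - x₀ i) * m x) x (EuclideanSpace.single i 1))
    (ha : ContDiff ℝ 2 a) (hb : Continuous b) (ha0 : ∀ x ∉ K, a x = 0) (q P : ℝ) :
    ∫ x, (2 * a x * b x + a x ^ 2 * (P * (n * c - c ^ 2 * ‖x - x₀‖ ^ 2))) * m x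
      = -2 * q * (∫ x, (∑ i, partialDeriv i a x ^ 2) * m x)
        + 2 * (∫ x, (b x - q * ∑ i, partialDeriv i (partialDeriv i a) x) * a x * m x)
        + (P - q) * ∫ x, a x ^ 2 * (n * c - c ^ 2 * ‖x - x₀‖ ^ 2) * m x := by
  have ha1 i : ContDiff ℝ 1 (partialDeriv i a) := ha.partialDeriv (by norm_num) i
  have ha2 i j : Continuous (partialDeriv i (partialDeriv j a)) :=
    ((ha1 j).partialDeriv (k := 0) (by norm_num) i).continuous
  have ha10 i := partialDeriv_eq_zero_of_notMem hK.isClosed ha0 i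
  have ha20 i j := partialDeriv_eq_zero_of_notMem hK.isClosed (ha10 j) i
  have ha1c i := (ha1 i).continuous
  have hac := ha.continuous
  have hA := integral_weighted_green hK hm hdm ha (ha.of_le (by norm_num)) ha0
  have hB := integral_weighted_sq_drift hK hm hdm (ha.of_le (by norm_num)) ha0
  have key := integral_sum_mul_weight hK hm ![2 * q, -q, -2 * q, 2, P - q]
    ![fun x => (∑ i, partialDeriv i a x * partialDeriv i a x)
      + a x * ((∑ i, partialDeriv i (partialDeriv i a) x)
        + ∑ i, -c * (x i - x₀ i) * partialDeriv i a x),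
      fun x => 2 * a x * (∑ i, -c * (x i - x₀ i) * partialDeriv i a x)
      - a x ^ 2 * (n * c - c ^ 2 * ‖x - x₀‖ ^ 2),
      fun x => ∑ i, partialDeriv i a x ^ 2,
      fun x => (b x - q * ∑ i, partialDeriv i (partialDeriv i a) x) * a x,
      fun x => a x ^ 2 * (n * c - c ^ 2 * ‖x - x₀‖ ^ 2)]
    (by
      simp only [Fin.forall_fin_succ, Fin.forall_fin_zero, Matrix.cons_val_zero,
        Matrix.cons_val_succ, and_true]
      refine ⟨?_, ?_, ?_, ?_, ?_⟩ <;> fun_prop)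
    (by
      simp only [Fin.forall_fin_succ, Fin.forall_fin_zero, Matrix.cons_val_zero,
        Matrix.cons_val_succ, and_true]
      refine ⟨?_, ?_, ?_, ?_, ?_⟩ <;> intro x hx <;> simp [ha0 x hx, fun i => ha10 i x hx])
  simp only [Fin.sum_univ_succ, Fin.sum_univ_zero, Matrix.cons_val_zero,
    Matrix.cons_val_succ, hA, hB] at key
  convert key using 1
  · congr 1
    ext x
    simp only [sq]
    ring
  · ring

/-- The derivative of `∫ |∇a|² m`, where `b` is the time derivative of `a`. -/
lemma integral_weighted_dirichlet_rate (hK : IsCompact K) (hm : Continuous m)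
    (hdm : ∀ i x, HasLineDerivAt ℝ m (-c * (x i - x₀ i) * m x) x (EuclideanSpace.single i 1))
    (ha : ContDiff ℝ 2 a) (hb : ContDiff ℝ 1 b) (ha0 : ∀ x ∉ K, a x = 0) (q P : ℝ) :
    ∫ x, (2 * (∑ i, partialDeriv i b x * partialDeriv i a x)
        + (∑ i, partialDeriv i a x ^ 2) * (P * (n * c - c ^ 2 * ‖x - x₀‖ ^ 2))) * m x
      = -2 * q * (∫ x, ((∑ i, partialDeriv i (partialDeriv i a) x)
          + ∑ i, -c * (x i - x₀ i) * partialDeriv i a x) ^ 2 * m x)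
        - 2 * (∫ x, (b x - q * ∑ i, partialDeriv i (partialDeriv i a) x)
          * ((∑ i, partialDeriv i (partialDeriv i a) x)
          + ∑ i, -c * (x i - x₀ i) * partialDeriv i a x) * m x)
        + 2 * q * c * (∫ x, (∑ i, partialDeriv i a x ^ 2) * m x)
        + (P - q) * ∫ x, (∑ i, partialDeriv i a x ^ 2)
          * (n * c - c ^ 2 * ‖x - x₀‖ ^ 2) * m x := by
  have ha1 i : ContDiff ℝ 1 (partialDeriv i a) := ha.partialDeriv (by norm_num) i
  have ha2 i j : Continuous (partialDeriv i (partialDeriv j a)) :=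
    ((ha1 j).partialDeriv (k := 0) (by norm_num) i).continuous
  have hb1 i : Continuous (partialDeriv i b) :=
    (hb.partialDeriv (k := 0) (by norm_num) i).continuous
  have ha10 i := partialDeriv_eq_zero_of_notMem hK.isClosed ha0 i
  have ha20 i j := partialDeriv_eq_zero_of_notMem hK.isClosed (ha10 j) i
  have ha1c i := (ha1 i).continuous
  have hbc := hb.continuous
  have hC := integral_weighted_green hK hm hdm ha hb ha0
  have hD := integral_weighted_rellich hK hm hdm ha ha0
  have key := integral_sum_mul_weight hK hm ![2, q, -2 * q, -2, 2 * q * c, P - q]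
    ![fun x => (∑ i, partialDeriv i b x * partialDeriv i a x)
      + b x * ((∑ i, partialDeriv i (partialDeriv i a) x)
        + ∑ i, -c * (x i - x₀ i) * partialDeriv i a x),
      fun x => 2 * (∑ i, -c * (x i - x₀ i) * partialDeriv i a x)
        * ((∑ i, partialDeriv i (partialDeriv i a) x)
          + ∑ i, -c * (x i - x₀ i) * partialDeriv i a x)
      - 2 * c * (∑ i, partialDeriv i a x ^ 2)
      + (∑ i, partialDeriv i a x ^ 2) * (n * c - c ^ 2 * ‖x - x₀‖ ^ 2),
      fun x => ((∑ i, partialDeriv i (partialDeriv i a) x)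
          + ∑ i, -c * (x i - x₀ i) * partialDeriv i a x) ^ 2,
      fun x => (b x - q * ∑ i, partialDeriv i (partialDeriv i a) x)
          * ((∑ i, partialDeriv i (partialDeriv i a) x)
          + ∑ i, -c * (x i - x₀ i) * partialDeriv i a x),
      fun x => ∑ i, partialDeriv i a x ^ 2,
      fun x => (∑ i, partialDeriv i a x ^ 2) * (n * c - c ^ 2 * ‖x - x₀‖ ^ 2)]
    (by
      simp only [Fin.forall_fin_succ, Fin.forall_fin_zero, Matrix.cons_val_zero,
        Matrix.cons_val_succ, and_true]
      refine ⟨?_, ?_, ?_, ?_, ?_, ?_⟩ <;> fun_prop)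
    (by
      simp only [Fin.forall_fin_succ, Fin.forall_fin_zero, Matrix.cons_val_zero,
        Matrix.cons_val_succ, and_true]
      refine ⟨?_, ?_, ?_, ?_, ?_, ?_⟩ <;> intro x hx <;>
        simp [fun i => ha10 i x hx, fun i => ha20 i i x hx])
  simp only [Fin.sum_univ_succ, Fin.sum_univ_zero, Matrix.cons_val_zero,
    Matrix.cons_val_succ, hC, hD] at key
  convert key using 1
  · congr 1
    ext x
    ring
  · ring

lemma weighted_square_nonneg (hK : IsCompact K) (hm : Continuous m) (hm0 : ∀ x, 0 ≤ m x)
    (hdm : ∀ i x, HasLineDerivAt ℝ m (-c * (x i - x₀ i) * m x) x (EuclideanSpace.single i 1))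
    (ha : ContDiff ℝ 2 a) (hb : Continuous b) (ha0 : ∀ x ∉ K, a x = 0) (hb0 : ∀ x ∉ K, b x = 0)
    (q l : ℝ) :
    0 ≤ q ^ 2 * (∫ x, ((∑ i, partialDeriv i (partialDeriv i a) x)
          + ∑ i, -c * (x i - x₀ i) * partialDeriv i a x) ^ 2 * m x)
        + q * (∫ x, (b x - q * ∑ i, partialDeriv i (partialDeriv i a) x)
          * ((∑ i, partialDeriv i (partialDeriv i a) x)
          + ∑ i, -c * (x i - x₀ i) * partialDeriv i a x) * m x)
        + 1 / 4 * (∫ x, (b x - q * ∑ i, partialDeriv i (partialDeriv i a) x) ^ 2 * m x)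
        - 2 * l * q * (∫ x, (∑ i, partialDeriv i a x ^ 2) * m x)
        + l * (∫ x, (b x - q * ∑ i, partialDeriv i (partialDeriv i a) x) * a x * m x)
        + l ^ 2 * ∫ x, a x ^ 2 * m x := by
  have ha1 i : ContDiff ℝ 1 (partialDeriv i a) := ha.partialDeriv (by norm_num) i
  have ha2 i j : Continuous (partialDeriv i (partialDeriv j a)) :=
    ((ha1 j).partialDeriv (k := 0) (by norm_num) i).continuous
  have ha10 i := partialDeriv_eq_zero_of_notMem hK.isClosed ha0 i
  have ha20 i j := partialDeriv_eq_zero_of_notMem hK.isClosed (ha10 j) i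
  have ha1c i := (ha1 i).continuous
  have hac := ha.continuous
  have hA := integral_weighted_green hK hm hdm ha (ha.of_le (by norm_num)) ha0
  have key := integral_sum_mul_weight hK hm ![q ^ 2, q, 1 / 4, 2 * l * q, -2 * l * q, l, l ^ 2]
    ![fun x => ((∑ i, partialDeriv i (partialDeriv i a) x)
          + ∑ i, -c * (x i - x₀ i) * partialDeriv i a x) ^ 2,
      fun x => (b x - q * ∑ i, partialDeriv i (partialDeriv i a) x)
          * ((∑ i, partialDeriv i (partialDeriv i a) x)
          + ∑ i, -c * (x i - x₀ i) * partialDeriv i a x),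
      fun x => (b x - q * ∑ i, partialDeriv i (partialDeriv i a) x) ^ 2,
      fun x => (∑ i, partialDeriv i a x * partialDeriv i a x)
      + a x * ((∑ i, partialDeriv i (partialDeriv i a) x)
        + ∑ i, -c * (x i - x₀ i) * partialDeriv i a x),
      fun x => ∑ i, partialDeriv i a x ^ 2,
      fun x => (b x - q * ∑ i, partialDeriv i (partialDeriv i a) x) * a x,
      fun x => a x ^ 2]
    (by
      simp only [Fin.forall_fin_succ, Fin.forall_fin_zero, Matrix.cons_val_zero,
        Matrix.cons_val_succ, and_true]
      refine ⟨?_, ?_, ?_, ?_, ?_, ?_, ?_⟩ <;> fun_prop)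
    (by
      simp only [Fin.forall_fin_succ, Fin.forall_fin_zero, Matrix.cons_val_zero,
        Matrix.cons_val_succ, and_true]
      refine ⟨?_, ?_, ?_, ?_, ?_, ?_, ?_⟩ <;> intro x hx <;>
        simp [ha0 x hx, hb0 x hx, fun i => ha10 i x hx, fun i => ha20 i i x hx])
  simp only [Fin.sum_univ_succ, Fin.sum_univ_zero, Matrix.cons_val_zero,
    Matrix.cons_val_succ, hA] at key
  have hsq : 0 ≤ ∫ x, (q * ((∑ i, partialDeriv i (partialDeriv i a) x)
          + ∑ i, -c * (x i - x₀ i) * partialDeriv i a x)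
        + (b x - q * ∑ i, partialDeriv i (partialDeriv i a) x) / 2 + l * a x) ^ 2 * m x :=
    integral_nonneg fun x => mul_nonneg (sq_nonneg _) (hm0 x)
  convert hsq.trans_eq (Eq.trans ?_ key) using 1
  · ring
  · congr 1
    ext x
    simp only [sq]
    ring

end Energy

section Time

variable {n : ℕ}

/-- Differentiation under the integral sign for integrands supported in a fixed compact set. -/
lemma hasDerivAt_integral_of_eq_zero_off {K : Set (EuclideanSpace ℝ (Fin n))} (hK : IsCompact K)
    {I : Set ℝ} (hI : IsOpen I) {F F' : EuclideanSpace ℝ (Fin n) → ℝ → ℝ}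
    (hF : ∀ t ∈ I, Continuous fun x => F x t)
    (hd : ∀ x, ∀ t ∈ I, HasDerivAt (F x) (F' x t) t)
    (hF' : ContinuousOn (fun q : EuclideanSpace ℝ (Fin n) × ℝ => F' q.1 q.2) (Set.univ ×ˢ I))
    (hF0 : ∀ t ∈ I, ∀ x ∉ K, F x t = 0) {t : ℝ} (ht : t ∈ I) :
    HasDerivAt (fun s => ∫ x, F x s) (∫ x, F' x t) t := by
  obtain ⟨ε, hε, hεI⟩ := Metric.isOpen_iff.1 hI t ht
  have hsub : Metric.closedBall t (ε / 2) ⊆ I :=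
    (Metric.closedBall_subset_ball (by linarith)).trans hεI
  have hF'0 : ∀ s ∈ I, ∀ x ∉ K, F' x s = 0 := by
    intro s hs x hx
    refine (hd x s hs).unique ((hasDerivAt_const s (0 : ℝ)).congr_of_eventuallyEq ?_)
    filter_upwards [hI.mem_nhds hs] with r hr using hF0 r hr x hx
  obtain ⟨C, hC⟩ := (hK.prod (isCompact_closedBall t (ε / 2))).exists_bound_of_continuousOn
    (hF'.mono (Set.prod_mono (Set.subset_univ K) hsub))
  have hcont : Continuous fun x => F' x t := by
    rw [← continuousOn_univ]
    exact hF'.comp (f := fun x => (x, t)) (by fun_prop) fun x _ => ⟨trivial, ht⟩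
  refine (hasDerivAt_integral_of_dominated_loc_of_deriv_le (F := fun s x => F x s)
    (F' := fun s x => F' x s) (bound := K.indicator fun _ => C)
    (Metric.closedBall_mem_nhds t (by linarith : 0 < ε / 2)) ?_ ?_ ?_ ?_ ?_ ?_).2
  · filter_upwards [hI.mem_nhds ht] with s hs using (hF s hs).aestronglyMeasurable
  · exact (hF t ht).integrable_of_eq_zero_off hK (hF0 t ht)
  · exact hcont.aestronglyMeasurable
  · refine Filter.Eventually.of_forall fun x s hs => ?_
    by_cases hx : x ∈ K
    · simpa [hx] using hC (x, s) ⟨hx, hs⟩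
    · simp [hx, hF'0 s (hsub hs) x hx]
  · exact (integrable_indicator_iff hK.measurableSet).2
      (integrableOn_const hK.measure_lt_top.ne)
  · exact Filter.Eventually.of_forall fun x s hs => hd x s (hsub hs)

variable {f : EuclideanSpace ℝ (Fin n) × ℝ → ℝ}

lemma partialDeriv_slice (hf : ContDiff ℝ 1 f) (i : Fin n) (x : EuclideanSpace ℝ (Fin n))
    (t : ℝ) :
    partialDeriv i (fun y => f (y, t)) x = fderiv ℝ f (x, t) (EuclideanSpace.single i 1, 0) := by
  have h := (hf.differentiable (by norm_num) (x, t)).hasFDerivAt.comp (f := fun y => (y, t)) x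
    ((hasFDerivAt_id x).prodMk (hasFDerivAt_const t x))
  have h2 : fderiv ℝ (fun y => f (y, t)) x = _ := h.fderiv
  rw [partialDeriv, h2]
  simp

lemma hasDerivAt_slice (hf : ContDiff ℝ 1 f) (x : EuclideanSpace ℝ (Fin n)) (t : ℝ) :
    HasDerivAt (fun s => f (x, s)) (fderiv ℝ f (x, t) (0, 1)) t :=
  (hf.differentiable (by norm_num) (x, t)).hasFDerivAt.comp_hasDerivAt t
    ((hasDerivAt_const t x).prodMk (hasDerivAt_id t))

lemma hasDerivAt_partialDeriv_slice (hf : ContDiff ℝ 2 f) (i : Fin n)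
    (x : EuclideanSpace ℝ (Fin n)) (t : ℝ) :
    HasDerivAt (fun s => partialDeriv i (fun y => f (y, s)) x)
      (partialDeriv i (fun y => fderiv ℝ f (y, t) (0, 1)) x) t := by
  have hf' : ContDiff ℝ 1 (fderiv ℝ f) := hf.fderiv_right (by norm_num)
  have hd := hf'.differentiable (by norm_num) (x, t)
  have hf1 : ContDiff ℝ 1 f := hf.of_le (by norm_num)
  have h := hasDerivAt_slice (f := fun q => fderiv ℝ f q (EuclideanSpace.single i 1, 0))
    (hf'.clm_apply contDiff_const) x t
  simp only [partialDeriv_slice hf1]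
  refine h.congr_deriv ?_
  rw [partialDeriv_slice (f := fun q => fderiv ℝ f q (0, 1)) (hf'.clm_apply contDiff_const),
    fderiv_clm_apply hd (by fun_prop), fderiv_clm_apply hd (by fun_prop)]
  simpa using (hf.contDiffAt.isSymmSndFDerivAt (by simp)) _ _

end Time

lemma hasDerivAt_heatWeight (n : ℕ) (r P s₁ t : ℝ) (hP : P ≠ 0) (hs : t < s₁) :
    HasDerivAt (fun t => -r ^ 2 / (4 * P * (s₁ - t)) - (n / 2 : ℝ) * Real.log (s₁ - t))
      (P * (n * (1 / (2 * P * (s₁ - t))) - (1 / (2 * P * (s₁ - t))) ^ 2 * r ^ 2)) t := by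
  have hs' : s₁ - t ≠ 0 := by linarith
  have h1 : HasDerivAt (fun t => s₁ - t) (-1) t := by
    simpa using (hasDerivAt_id t).const_sub s₁
  refine HasDerivAt.congr_deriv (((hasDerivAt_const t (-r ^ 2)).div (h1.const_mul (4 * P))
    (by positivity)).sub ((h1.log hs').const_mul (n / 2 : ℝ))) ?_
  field_simp
  ring

lemma hasLineDerivAt_heatWeight {n : ℕ} (x₀ : EuclideanSpace ℝ (Fin n)) (P s A : ℝ)
    (i : Fin n) (x : EuclideanSpace ℝ (Fin n)) :
    HasLineDerivAt ℝ (fun y => Real.exp (-‖y - x₀‖ ^ 2 / (4 * P * s) - A))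
      (-(1 / (2 * P * s)) * (x i - x₀ i) * Real.exp (-‖x - x₀‖ ^ 2 / (4 * P * s) - A)) x
      (EuclideanSpace.single i 1) := by
  have h : HasFDerivAt (fun y : EuclideanSpace ℝ (Fin n) => y - x₀)
      (ContinuousLinearMap.id ℝ _) x := (hasFDerivAt_id x).sub_const x₀
  have h2 := (((h.norm_sq.neg.mul_const (4 * P * s)⁻¹).sub_const A).exp).hasLineDerivAt
    (EuclideanSpace.single i 1)
  simp only [← div_eq_mul_inv] at h2
  refine HasDerivAt.congr_deriv h2 ?_
  have hi : inner ℝ (x - x₀) (EuclideanSpace.single i 1) = x i - x₀ i := by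
    rw [EuclideanSpace.inner_single_right]
    simp
  change Real.exp (-‖x - x₀‖ ^ 2 / (4 * P * s) - A)
    * ((4 * P * s)⁻¹ * -(2 • inner ℝ (x - x₀) (EuclideanSpace.single i 1))) = _
  rw [hi, one_div, mul_inv, mul_inv, mul_inv, mul_inv, nsmul_eq_mul]
  push_cast
  ring

/-- The frequency inequality from the evolution laws of the mass `y` and the Dirichlet integral `G`,
bounds on the potential terms, and non-negativity of a completed square. -/
lemma frequency_algebra {n : ℕ} {p₁ p p' P M s R c y G U V W S Q Q' y' G' : ℝ}
    (hp₁ : 0 < p₁) (hp : p₁ ≤ p) (hP : p₁ ≤ P) (hp' : |p'| ≤ M) (hs : 0 < s)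
    (hPp : |P - p| ≤ M * s) (hc : c = 1 / (2 * P * s)) (hy : 0 < y) (hG : 0 ≤ G)
    (hy' : y' = -2 * p * G + 2 * S + (P - p) * Q)
    (hG' : G' = -2 * p * U - 2 * V + 2 * p * c * G + (P - p) * Q')
    (hQ : |Q| ≤ (n * c + c ^ 2 * R ^ 2) * y) (hQ' : |Q'| ≤ (n * c + c ^ 2 * R ^ 2) * G)
    (hsq : 0 ≤ p ^ 2 * U + p * V + 1 / 4 * W - 2 * (p * G / y) * p * G
      + (p * G / y) * S + (p * G / y) ^ 2 * y) :
    ((p' * G + p * G') * y - p * G * y') / y ^ 2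
      ≤ ((1 + M * R ^ 2 / (2 * p₁ ^ 2)) / s + (2 + n) * M / p₁) * (p * G / y)
        + 1 / (2 * y) * W := by
  have hp0 : 0 < p := hp₁.trans_le hp
  have hP0 : 0 < P := hp₁.trans_le hP
  have hM : 0 ≤ M := (abs_nonneg _).trans hp'
  set N := p * G / y with hN
  have hNy : N * y = p * G := by rw [hN]; field_simp
  have hN0 : 0 ≤ N := by positivity
  have hc0 : 0 < c := by rw [hc]; positivity
  set κ := n * c + c ^ 2 * R ^ 2 with hκ
  have hκ0 : 0 ≤ κ := by positivity
  have e1 : p' * G ≤ M / p₁ * (p * G) := by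
    have h1 : p' ≤ M / p₁ * p := by
      calc p' ≤ M := (le_abs_self _).trans hp'
        _ = M / p₁ * p₁ := by field_simp
        _ ≤ M / p₁ * p := by gcongr
    calc p' * G ≤ M / p₁ * p * G := by gcongr
      _ = _ := by ring
  have e2 : 2 * p * c ≤ 1 / s + M / p₁ := by
    have h1 : p ≤ P + M * s := by linarith [neg_abs_le (P - p)]
    calc 2 * p * c = p * (1 / (P * s)) := by rw [hc]; field_simp
      _ ≤ (P + M * s) * (1 / (P * s)) := by gcongr
      _ = 1 / s + M / P := by field_simp
      _ ≤ 1 / s + M / p₁ := by gcongr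
  have e3 : 2 * (|P - p| * κ) ≤ n * M / p₁ + M * R ^ 2 / (2 * p₁ ^ 2) / s := by
    calc 2 * (|P - p| * κ) ≤ 2 * (M * s * κ) := by gcongr
      _ = n * M / P + M * R ^ 2 / (2 * P ^ 2) / s := by rw [hκ, hc]; field_simp
      _ ≤ n * M / p₁ + M * R ^ 2 / (2 * p₁ ^ 2) / s := by gcongr
  have e4 : (P - p) * Q' ≤ |P - p| * (κ * G) :=
    (le_abs_self _).trans (by rw [abs_mul]; gcongr)
  have e5 : -((P - p) * Q) ≤ |P - p| * (κ * y) :=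
    (neg_le_abs _).trans (by rw [abs_mul]; gcongr)
  have e4' := mul_le_mul_of_nonneg_left e4 hp0.le
  have e5' := mul_le_mul_of_nonneg_left e5 hN0
  have e5'' : N * (|P - p| * (κ * y)) = |P - p| * κ * (p * G) := by rw [← hNy]; ring
  have hpG : 0 ≤ p * G := by positivity
  have e2' := mul_le_mul_of_nonneg_right e2 hpG
  have e3' := mul_le_mul_of_nonneg_right e3 hpG
  have hN2 : N ^ 2 * y = N * p * G := by rw [sq, mul_assoc, hNy]; ring
  have main : p' * G + p * G' - N * y' ≤
      ((1 + M * R ^ 2 / (2 * p₁ ^ 2)) / s + (2 + n) * M / p₁) * (p * G) + 1 / 2 * W := by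
    have hcoef : (1 + M * R ^ 2 / (2 * p₁ ^ 2)) / s + (2 + n) * M / p₁
        = 1 / s + M / p₁ + M / p₁ + (n * M / p₁ + M * R ^ 2 / (2 * p₁ ^ 2) / s) := by ring
    rw [hcoef, hy', hG']
    rw [hN2] at hsq
    rw [e5''] at e5'
    linarith
  have hL : ((p' * G + p * G') * y - p * G * y') / y ^ 2 = (p' * G + p * G' - N * y') / y := by
    rw [hN]; field_simp
  rw [hL, div_le_iff₀ hy]
  refine main.trans_eq ?_
  rw [hN]; field_simp


/-- Interior version of Corollary 1(ii): the frequency-function differential inequality of the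
logarithmic convexity method with the explicit backward heat-kernel weight `φ`:
`N′ ≤ ((1+C₀)/(T−t+ρ) + C₁) N + (1/(2y))∫w²e^φ`, with `C₀ = MR²/(2p₁²)`, `C₁ = (2+n)M/p₁`. -/
theorem frequency_inequality_weighted
    (n : ℕ) (hn : 1 ≤ n) (x₀ : EuclideanSpace ℝ (Fin n))
    (R T ρ p₁ p₂ M : ℝ) (hR : 0 < R) (hT : 0 < T) (hρ : 0 < ρ)
    (ϑ : Set (EuclideanSpace ℝ (Fin n))) (hϑ : IsOpen ϑ) (hϑR : ϑ ⊆ Metric.ball x₀ R)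
    (p : ℝ → ℝ) (hp : ContDiff ℝ 1 p)
    (hp₁ : 0 < p₁) (hpbd : ∀ t ∈ Set.Icc (0 : ℝ) T, p₁ ≤ p t ∧ p t ≤ p₂)
    (hp' : ∀ t ∈ Set.Icc (0 : ℝ) T, |deriv p t| ≤ M)
    (φ : EuclideanSpace ℝ (Fin n) → ℝ → ℝ)
    (hφ : ∀ x t, φ x t =
      -‖x - x₀‖ ^ 2 / (4 * p T * (T - t + ρ)) - (n / 2 : ℝ) * Real.log (T - t + ρ))
    (z : EuclideanSpace ℝ (Fin n) → ℝ → ℝ)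
    (hz : ContDiff ℝ (⊤ : ℕ∞) (fun q : EuclideanSpace ℝ (Fin n) × ℝ => z q.1 q.2))
    (K : Set (EuclideanSpace ℝ (Fin n))) (hK : IsCompact K) (hKϑ : K ⊆ ϑ)
    (hsupp : ∀ t ∈ Set.Icc (0 : ℝ) T, Function.support (fun x => z x t) ⊆ K)
    (w : EuclideanSpace ℝ (Fin n) → ℝ → ℝ)
    (hw : ∀ x t, w x t = deriv (z x) t - p t * lapl (fun y => z y t) x)
    (y N : ℝ → ℝ)
    (hy : ∀ t, y t = ∫ x in ϑ, (z x t) ^ 2 * Real.exp (φ x t))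
    (hypos : ∀ t ∈ Set.Icc (0 : ℝ) T, 0 < y t)
    (hN : ∀ t, N t =
      p t * (∫ x in ϑ, ‖gradient (fun x' => z x' t) x‖ ^ 2 * Real.exp (φ x t)) / y t) :
    ∀ t ∈ Set.Ioo (0 : ℝ) T,
      deriv N t ≤
        ((1 + M * R ^ 2 / (2 * p₁ ^ 2)) / (T - t + ρ) + (2 + n) * M / p₁) * N t
          + (1 / (2 * y t)) * ∫ x in ϑ, (w x t) ^ 2 * Real.exp (φ x t) := by
  intro t ht
  set P := p T with hPdef
  have hTI : T ∈ Set.Icc (0 : ℝ) T := ⟨hT.le, le_rfl⟩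
  have hP0 : 0 < P := hp₁.trans_le (hpbd T hTI).1
  have htI := Set.Ioo_subset_Icc_self ht
  have hs : ∀ r ∈ Set.Ioo (0 : ℝ) T, 0 < T - r + ρ := fun r hr => by linarith [hr.2]
  set f : EuclideanSpace ℝ (Fin n) × ℝ → ℝ := fun q => z q.1 q.2 with hf
  have hf2 : ContDiff ℝ 2 f := contDiff_infty.1 hz 2
  have hf3 : ContDiff ℝ 3 f := contDiff_infty.1 hz 3
  have hf1 : ContDiff ℝ 1 f := hf2.of_le (by norm_num)
  have hdf : ContDiff ℝ 2 (fderiv ℝ f) := hf3.fderiv_right (by norm_num)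
  set b : EuclideanSpace ℝ (Fin n) → ℝ → ℝ := fun x r => fderiv ℝ f (x, r) (0, 1) with hb
  have hslice : ∀ r, ContDiff ℝ 2 fun x => z x r := fun r =>
    hf2.comp (contDiff_id.prodMk contDiff_const)
  have hbf : ContDiff ℝ 2 fun q : EuclideanSpace ℝ (Fin n) × ℝ => b q.1 q.2 :=
    hdf.clm_apply contDiff_const
  have hbslice : ∀ r, ContDiff ℝ 2 fun x => b x r := fun r =>
    hbf.comp (contDiff_id.prodMk contDiff_const)
  have hz0 : ∀ r ∈ Set.Icc (0 : ℝ) T, ∀ x ∉ K, z x r = 0 := fun r hr x hx => by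
    by_contra h
    exact hx (hsupp r hr h)
  have hdz : ∀ x r, HasDerivAt (z x) (b x r) r := fun x r => hasDerivAt_slice hf1 x r
  have hb0 : ∀ r ∈ Set.Ioo (0 : ℝ) T, ∀ x ∉ K, b x r = 0 := by
    intro r hr x hx
    refine (hdz x r).unique ((hasDerivAt_const r (0 : ℝ)).congr_of_eventuallyEq ?_)
    filter_upwards [isOpen_Ioo.mem_nhds hr] with r' hr'
      using hz0 r' (Set.Ioo_subset_Icc_self hr') x hx
  have hzi0 : ∀ r ∈ Set.Icc (0 : ℝ) T, ∀ i, ∀ x ∉ K, partialDeriv i (fun y => z y r) x = 0 :=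
    fun r hr i => partialDeriv_eq_zero_of_notMem hK.isClosed (hz0 r hr) i
  have hweq : ∀ x r, w x r
      = b x r - p r * ∑ i, partialDeriv i (partialDeriv i fun y => z y r) x := fun x r => by
    rw [hw, (hdz x r).deriv, lapl_eq_sum_partialDeriv (hslice r)]
  have hw0 : ∀ x ∉ K, w x t = 0 := fun x hx => by
    rw [hweq, hb0 t ht x hx]
    simp [fun i => partialDeriv_eq_zero_of_notMem hK.isClosed (hzi0 t htI i) i x hx]
  set m : EuclideanSpace ℝ (Fin n) → ℝ → ℝ := fun x r => Real.exp (φ x r) with hm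
  set c := 1 / (2 * P * (T - t + ρ)) with hc
  have hmc : ∀ r, Continuous fun x => m x r := fun r => by
    simp only [hm, hφ]
    fun_prop
  have hdm : ∀ i x, HasLineDerivAt ℝ (fun y => m y t) (-c * (x i - x₀ i) * m x t) x
      (EuclideanSpace.single i 1) := fun i x => by
    simp only [hm, hφ]
    exact hasLineDerivAt_heatWeight x₀ P (T - t + ρ) _ i x
  set k : EuclideanSpace ℝ (Fin n) → ℝ → ℝ := fun x r =>
    P * (n * (1 / (2 * P * (T - r + ρ))) - (1 / (2 * P * (T - r + ρ))) ^ 2 * ‖x - x₀‖ ^ 2) with hk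
  have hmt : ∀ x, ∀ r ∈ Set.Ioo (0 : ℝ) T, HasDerivAt (m x) (m x r * k x r) r := by
    intro x r hr
    have h := (hasDerivAt_heatWeight n ‖x - x₀‖ P (T + ρ) r hP0.ne' (by linarith [hr.2])).exp
    simp only [show ∀ r, T + ρ - r = T - r + ρ from fun r => by ring] at h
    simpa only [hm, hk, hφ] using h
  have hden : ∀ q : EuclideanSpace ℝ (Fin n) × ℝ, q ∈ Set.univ ×ˢ Set.Ioo (0 : ℝ) T →
      T - q.2 + ρ ≠ 0 := fun q hq => (hs q.2 hq.2).ne'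
  have hmcont : ContinuousOn (fun q : EuclideanSpace ℝ (Fin n) × ℝ => m q.1 q.2)
      (Set.univ ×ˢ Set.Ioo (0 : ℝ) T) := by
    simp only [hm, hφ]
    refine ContinuousOn.rexp (ContinuousOn.sub (ContinuousOn.div (by fun_prop) (by fun_prop) ?_)
      (ContinuousOn.mul (by fun_prop) (ContinuousOn.log (by fun_prop) hden)))
    intro q hq
    have := hden q hq
    positivity
  have hkcont : ContinuousOn (fun q : EuclideanSpace ℝ (Fin n) × ℝ => k q.1 q.2)
      (Set.univ ×ˢ Set.Ioo (0 : ℝ) T) := by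
    have h : ContinuousOn (fun q : EuclideanSpace ℝ (Fin n) × ℝ => 1 / (2 * P * (T - q.2 + ρ)))
        (Set.univ ×ˢ Set.Ioo (0 : ℝ) T) := by
      refine ContinuousOn.div (by fun_prop) (by fun_prop) fun q hq => ?_
      have := hden q hq
      positivity
    simp only [hk]
    fun_prop
  have hyfull : ∀ r ∈ Set.Icc (0 : ℝ) T, y r = ∫ x, z x r ^ 2 * m x r := fun r hr => by
    rw [hy, setIntegral_eq_integral_of_forall_compl_eq_zero]
    intro x hx
    simp [hz0 r hr x fun h => hx (hKϑ h)]
  set G : ℝ → ℝ := fun r => ∫ x, (∑ i, partialDeriv i (fun y => z y r) x ^ 2) * m x r with hG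
  have hNfull : ∀ r ∈ Set.Icc (0 : ℝ) T, N r = p r * G r / y r := fun r hr => by
    rw [hN, setIntegral_eq_integral_of_forall_compl_eq_zero]
    · simp only [norm_gradient_sq, hG, hm]
    · intro x hx
      simp [norm_gradient_sq, fun i => hzi0 r hr i x fun h => hx (hKϑ h)]
  have hWfull : ∫ x in ϑ, w x t ^ 2 * Real.exp (φ x t) = ∫ x, w x t ^ 2 * m x t := by
    rw [setIntegral_eq_integral_of_forall_compl_eq_zero]
    intro x hx
    simp [hw0 x fun h => hx (hKϑ h)]
  have hdy : HasDerivAt (fun r => ∫ x, z x r ^ 2 * m x r)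
      (∫ x, (2 * z x t * b x t + z x t ^ 2 * k x t) * m x t) t := by
    refine hasDerivAt_integral_of_eq_zero_off hK isOpen_Ioo
      (F' := fun x r => (2 * z x r * b x r + z x r ^ 2 * k x r) * m x r) ?_ ?_ ?_ ?_ ht
    · intro r _
      exact ((hslice r).continuous.pow 2).mul (hmc r)
    · intro x r hr
      refine (((hdz x r).pow 2).mul (hmt x r hr)).congr_deriv ?_
      simp
      ring
    · have h1 : Continuous fun q : EuclideanSpace ℝ (Fin n) × ℝ => z q.1 q.2 := hf1.continuous
      have h2 := hbf.continuous
      fun_prop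
    · intro r hr x hx
      simp [hz0 r (Set.Ioo_subset_Icc_self hr) x hx]
  have hdG : HasDerivAt G (∫ x, (2 * (∑ i, partialDeriv i (fun y => b y t) x
        * partialDeriv i (fun y => z y t) x)
      + (∑ i, partialDeriv i (fun y => z y t) x ^ 2) * k x t) * m x t) t := by
    refine hasDerivAt_integral_of_eq_zero_off hK isOpen_Ioo
      (F' := fun x r => (2 * (∑ i, partialDeriv i (fun y => b y r) x
        * partialDeriv i (fun y => z y r) x)
      + (∑ i, partialDeriv i (fun y => z y r) x ^ 2) * k x r) * m x r) ?_ ?_ ?_ ?_ ht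
    · intro r _
      have h i : Continuous (partialDeriv i fun y => z y r) :=
        ((hslice r).partialDeriv (k := 1) (by norm_num) i).continuous
      have := hmc r
      fun_prop
    · intro x r hr
      have h := HasDerivAt.fun_sum (u := Finset.univ)
        fun i _ => (hasDerivAt_partialDeriv_slice hf2 i x r).pow 2
      refine (h.mul (hmt x r hr)).congr_deriv ?_
      have hsum : ∑ i, (2 : ℕ) * partialDeriv i (fun y => f (y, r)) x ^ (2 - 1)
            * partialDeriv i (fun y => fderiv ℝ f (y, r) (0, 1)) x
          = 2 * ∑ i, partialDeriv i (fun y => b y r) x * partialDeriv i (fun y => z y r) x := by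
        rw [Finset.mul_sum]
        refine Finset.sum_congr rfl fun i _ => ?_
        simp only [hb, hf]
        push_cast
        ring
      rw [hsum]
      change _ + (∑ i, partialDeriv i (fun y => z y r) x ^ 2) * _ = _
      ring
    · have h1 i : Continuous fun q : EuclideanSpace ℝ (Fin n) × ℝ =>
          partialDeriv i (fun y => z y q.2) q.1 := by
        have : ∀ q : EuclideanSpace ℝ (Fin n) × ℝ, partialDeriv i (fun y => z y q.2) q.1 = _ :=
          fun q => partialDeriv_slice hf1 i q.1 q.2
        simp only [this]
        exact (hdf.clm_apply contDiff_const).continuous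
      have h2 i : Continuous fun q : EuclideanSpace ℝ (Fin n) × ℝ =>
          partialDeriv i (fun y => b y q.2) q.1 := by
        have hbf1 := hbf.of_le (m := 1) (by norm_num)
        have : ∀ q : EuclideanSpace ℝ (Fin n) × ℝ, partialDeriv i (fun y => b y q.2) q.1 = _ :=
          fun q => partialDeriv_slice hbf1 i q.1 q.2
        simp only [this]
        exact ((hbf.fderiv_right (m := 1) (by norm_num)).clm_apply contDiff_const).continuous
      exact ((continuous_const.mul (continuous_finsetSum _ fun i _ =>
        (h2 i).mul (h1 i))).continuousOn.add ((continuous_finsetSum _ fun i _ =>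
        (h1 i).pow 2).continuousOn.mul hkcont)).mul hmcont
    · intro r hr x hx
      simp [fun i => hzi0 r (Set.Ioo_subset_Icc_self hr) i x hx]
  have hyt := hypos t htI
  have hdp : HasDerivAt p (deriv p t) t := (hp.differentiable (by norm_num) t).hasDerivAt
  have hdN := ((hdp.mul hdG).div hdy
    (by rw [← hyfull t htI]; exact hyt.ne')).congr_of_eventuallyEq (f₁ := N) (by
      filter_upwards [isOpen_Ioo.mem_nhds ht] with r hr
      have hr' := Set.Ioo_subset_Icc_self hr
      rw [hNfull r hr', hyfull r hr']
      rfl)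
  have hPp : |P - p t| ≤ M * (T - t + ρ) := by
    have hM : 0 ≤ M := (abs_nonneg _).trans (hp' t htI)
    have h := (convex_Icc (0 : ℝ) T).norm_image_sub_le_of_norm_deriv_le (f := p) (C := M)
      (fun r _ => hp.differentiable (by norm_num) r) hp' htI hTI
    rw [Real.norm_eq_abs, Real.norm_eq_abs, abs_of_pos (by linarith [ht.2] : 0 < T - t)] at h
    exact h.trans (by gcongr; linarith)
  have hc0 : 0 ≤ c := by
    have := hs t ht
    positivity
  have hKR : ∀ x ∈ K, ‖x - x₀‖ ≤ R := fun x hx => by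
    rw [← dist_eq_norm]
    exact (Metric.mem_ball.1 (hϑR (hKϑ hx))).le
  have hm0 : ∀ x, 0 ≤ m x t := fun x => (Real.exp_pos _).le
  have hzi i : Continuous (partialDeriv i fun y => z y t) :=
    ((hslice t).partialDeriv (k := 1) (by norm_num) i).continuous
  have hb1 := (hbslice t).of_le (m := 1) (by norm_num)
  rw [hdN.deriv, hNfull t htI, hWfull, ← hyfull t htI]
  simp only [hweq]
  refine frequency_algebra (n := n) hp₁ (hpbd t htI).1 (hpbd T hTI).1 (hp' t htI) (hs t ht) hPp hc
    hyt (integral_nonneg fun x => mul_nonneg (Finset.sum_nonneg fun i _ => sq_nonneg _) (hm0 x))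
    (integral_weighted_mass_rate hK (hmc t) hdm (hslice t) hb1.continuous (hz0 t htI) (p t) P)
    (integral_weighted_dirichlet_rate hK (hmc t) hdm (hslice t) hb1 (hz0 t htI) (p t) P)
    ?_ ?_ ?_
  · rw [hyfull t htI]
    exact abs_integral_mul_potential_le hK (hmc t) hm0 hKR hc0 ((hslice t).continuous.pow 2)
      (fun x => sq_nonneg _) fun x hx => by simp [hz0 t htI x hx]
  · exact abs_integral_mul_potential_le hK (hmc t) hm0 hKR hc0 (by fun_prop)
      (fun x => Finset.sum_nonneg fun i _ => sq_nonneg _) fun x hx => by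
        simp [fun i => hzi0 t htI i x hx]
  · have h := weighted_square_nonneg hK (hmc t) hm0 hdm (hslice t) hb1.continuous (hz0 t htI)
      (hb0 t ht) (p t) (p t * G t / y t)
    rw [← hyfull t htI] at h
    exact h
end

section
/- Let T > 0, ρ > 0, C₀ ≥ 0, C₁ ≥ 0, let F : [0,T] → ℝ be continuous and nonnegative, and let y, N : [0,T] → ℝ be positive C¹ functions such that for all t ∈ [0,T]: | y′(t) + 2N(t)y(t) | ≤ ( C₀/(T − t + ρ) + C₁ + F(t) ) y(t) and N′(t) ≤ ( (1 + C₀)/(T − t + ρ) + C₁ ) N(t) + F(t)/2. Then for any 0 ≤ t₁ < t₂ < t₃ ≤ T: y(t₂)^{1+M} ≤ e^{G} · ( (T − t₁ + ρ)/(T − t₃ + ρ) )^{C₀(1+M)} · y(t₃) · y(t₁)^{M}, where M := ( ∫_{t₂}^{t₃} e^{C₁ s}/(T − s + ρ)^{1+C₀} ds ) / ( ∫_{t₁}^{t₂} e^{C₁ s}/(T − s + ρ)^{1+C₀} ds ) and G := (1+M) [ (t₃ − t₁) ∫_{t₁}^{t₃} F(s) ds + ∫_{t₁}^{t₃} F(s)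 ds + (t₃ − t₁) C₁ ]. -/
open Set MeasureTheory

/-- The increment of `f` is bounded by the integral of any continuous upper bound for `f'`. -/
lemma sub_le_integral_of_hasDerivAt_le {f f' g : ℝ → ℝ} {a b : ℝ} (hab : a ≤ b)
    (hf : ∀ t ∈ Icc a b, HasDerivAt f (f' t) t) (hg : ContinuousOn g (Icc a b))
    (hle : ∀ t ∈ Icc a b, f' t ≤ g t) : f b - f a ≤ ∫ t in a..b, g t :=
  intervalIntegral.sub_le_integral_of_hasDeriv_right_of_le hab
    (fun t ht => (hf t ht).continuousAt.continuousWithinAt)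
    (fun t ht => (hf t (Ioo_subset_Icc_self ht)).hasDerivWithinAt)
    (hg.integrableOn_Icc) (fun t ht => hle t (Ioo_subset_Icc_self ht))

/-- The integrating factor `exp (-C₁ t) (R - t) ^ p` and its derivative. -/
lemma hasDerivAt_exp_mul_rpow_sub {R p C t : ℝ} (ht : 0 < R - t) :
    HasDerivAt (fun s => Real.exp (-(C * s)) * (R - s) ^ p)
      (-(p / (R - t) + C) * (Real.exp (-(C * t)) * (R - t) ^ p)) t := by
  have h1 : HasDerivAt (fun s : ℝ => Real.exp (-(C * s))) (Real.exp (-(C * t)) * (-(C * 1))) t :=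
    (((hasDerivAt_id t).const_mul C).neg).exp
  have h2 : HasDerivAt (fun s : ℝ => (R - s) ^ p) (-1 * p * (R - t) ^ (p - 1)) t :=
    ((hasDerivAt_id t).const_sub R).rpow_const (Or.inl ht.ne')
  refine (h1.mul h2).congr_deriv ?_
  rw [Real.rpow_sub_one ht.ne']
  field_simp
  ring

/-- A function `N` with `N' ≤ a N + F / 2`, where `ψ' = -a ψ` and `ψ` is positive and antitone,
satisfies a Grönwall-type estimate for `N ψ`. -/
lemma mul_integratingFactor_sub_le {F N N' ψ a : ℝ → ℝ} {s t : ℝ} (hst : s ≤ t)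
    (hF : ContinuousOn F (Icc s t)) (hF0 : ∀ r ∈ Icc s t, 0 ≤ F r)
    (hN : ∀ r ∈ Icc s t, HasDerivAt N (N' r) r)
    (hψ : ∀ r ∈ Icc s t, HasDerivAt ψ (-a r * ψ r) r)
    (hψ0 : ∀ r ∈ Icc s t, 0 < ψ r) (hψs : ∀ r ∈ Icc s t, ψ r ≤ ψ s)
    (h : ∀ r ∈ Icc s t, N' r ≤ a r * N r + F r / 2) :
    N t * ψ t - N s * ψ s ≤ ψ s / 2 * ∫ r in s..t, F r := by
  rw [← intervalIntegral.integral_const_mul]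
  refine sub_le_integral_of_hasDerivAt_le (f := fun r => N r * ψ r) hst
    (fun r hr => (hN r hr).mul (hψ r hr)) (continuousOn_const.mul hF) fun r hr => ?_
  have e1 := mul_le_mul_of_nonneg_right (h r hr) (hψ0 r hr).le
  have e2 := mul_le_mul_of_nonneg_left (hψs r hr) (hF0 r hr)
  nlinarith

/-- The ODE lemma of the logarithmic convexity method (Lemma 2): two differential
inequalities for a positive energy `y` and frequency `N` imply a three-point Hölder-type
interpolation inequality for `y` with explicit exponent `M` and constant `e^G`. -/
theorem log_convexity_ode_lemma
    (T ρ C₀ C₁ : ℝ) (hT : 0 < T) (hρ : 0 < ρ) (hC₀ : 0 ≤ C₀) (hC₁ : 0 ≤ C₁)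
    (F y N y' N' : ℝ → ℝ)
    (hF : ContinuousOn F (Set.Icc 0 T)) (hFpos : ∀ t ∈ Set.Icc (0 : ℝ) T, 0 ≤ F t)
    (hypos : ∀ t ∈ Set.Icc (0 : ℝ) T, 0 < y t) (hNpos : ∀ t ∈ Set.Icc (0 : ℝ) T, 0 < N t)
    (hy : ∀ t ∈ Set.Icc (0 : ℝ) T, HasDerivAt y (y' t) t)
    (hN : ∀ t ∈ Set.Icc (0 : ℝ) T, HasDerivAt N (N' t) t)
    (hy' : ContinuousOn y' (Set.Icc 0 T)) (hN' : ContinuousOn N' (Set.Icc 0 T))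
    (h1 : ∀ t ∈ Set.Icc (0 : ℝ) T,
      |y' t + 2 * N t * y t| ≤ (C₀ / (T - t + ρ) + C₁ + F t) * y t)
    (h2 : ∀ t ∈ Set.Icc (0 : ℝ) T,
      N' t ≤ ((1 + C₀) / (T - t + ρ) + C₁) * N t + F t / 2)
    (t₁ t₂ t₃ : ℝ) (h01 : 0 ≤ t₁) (h12 : t₁ < t₂) (h23 : t₂ < t₃) (h3T : t₃ ≤ T)
    (M G : ℝ)
    (hM : M = (∫ s in t₂..t₃, Real.exp (C₁ * s) / (T - s + ρ) ^ (1 + C₀)) /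
              (∫ s in t₁..t₂, Real.exp (C₁ * s) / (T - s + ρ) ^ (1 + C₀)))
    (hG : G = (1 + M) * ((t₃ - t₁) * (∫ s in t₁..t₃, F s)
              + (∫ s in t₁..t₃, F s) + (t₃ - t₁) * C₁)) :
    y t₂ ^ (1 + M) ≤
      Real.exp G * ((T - t₁ + ρ) / (T - t₃ + ρ)) ^ (C₀ * (1 + M)) * y t₃ * y t₁ ^ M := by
  have hR : ∀ t ∈ Icc (0 : ℝ) T, 0 < T + ρ - t := fun t ht => by linarith [ht.2]
  have hRe : ∀ t : ℝ, T - t + ρ = T + ρ - t := fun t => by ring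
  simp only [hRe] at hM h1 h2 ⊢
  set φ : ℝ → ℝ := fun s => Real.exp (C₁ * s) / (T + ρ - s) ^ (1 + C₀) with hφ
  set ψ : ℝ → ℝ := fun s => Real.exp (-(C₁ * s)) * (T + ρ - s) ^ (1 + C₀) with hψ
  have hψ0 : ∀ t ∈ Icc (0 : ℝ) T, 0 < ψ t := fun t ht =>
    mul_pos (Real.exp_pos _) (Real.rpow_pos_of_pos (hR t ht) _)
  have hφψ : ∀ t, φ t = (ψ t)⁻¹ := fun t => by
    simp only [hφ, hψ, Real.exp_neg, mul_inv, inv_inv, div_eq_mul_inv]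
  have hψd : ∀ t ∈ Icc (0 : ℝ) T,
      HasDerivAt ψ (-((1 + C₀) / (T + ρ - t) + C₁) * ψ t) t := fun t ht =>
    hasDerivAt_exp_mul_rpow_sub (hR t ht)
  have hanti : ∀ s ∈ Icc (0 : ℝ) T, ∀ t ∈ Icc (0 : ℝ) T, s ≤ t → ψ t ≤ ψ s := by
    intro s hs t ht hst
    have := hR t ht
    have := hR s hs
    simp only [hψ]
    gcongr
  have hφc : ContinuousOn φ (Icc 0 T) := by
    have : φ = fun t => (ψ t)⁻¹ := funext hφψ
    rw [this]
    exact ContinuousOn.inv₀ (fun t ht => (hψd t ht).continuousAt.continuousWithinAt)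
      fun t ht => (hψ0 t ht).ne'
  have m1 : t₁ ∈ Icc (0 : ℝ) T := ⟨h01, by linarith⟩
  have m2 : t₂ ∈ Icc (0 : ℝ) T := ⟨by linarith, by linarith⟩
  have m3 : t₃ ∈ Icc (0 : ℝ) T := ⟨by linarith, h3T⟩
  have sub : ∀ {s t : ℝ}, s ∈ Icc (0 : ℝ) T → t ∈ Icc (0 : ℝ) T → Icc s t ⊆ Icc 0 T :=
    fun hs ht => Icc_subset_Icc hs.1 ht.2
  have int : ∀ {f : ℝ → ℝ} {s t : ℝ}, ContinuousOn f (Icc 0 T) → s ∈ Icc (0 : ℝ) T →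
      t ∈ Icc (0 : ℝ) T → IntervalIntegrable f volume s t := fun hf hs ht =>
    (hf.mono (uIcc_subset_Icc hs ht)).intervalIntegrable
  have Fnonneg : ∀ {s t : ℝ}, s ∈ Icc (0 : ℝ) T → t ∈ Icc (0 : ℝ) T → s ≤ t →
      0 ≤ ∫ r in s..t, F r := fun hs ht hst =>
    intervalIntegral.integral_nonneg hst fun r hr => hFpos r (sub hs ht hr)
  have gron : ∀ s ∈ Icc (0 : ℝ) T, ∀ t ∈ Icc (0 : ℝ) T, s ≤ t →
      N t * ψ t - N s * ψ s ≤ ψ s / 2 * ∫ r in s..t, F r := by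
    intro s hs t ht hst
    have hsub := sub hs ht
    exact mul_integratingFactor_sub_le hst (hF.mono hsub) (fun r hr => hFpos r (hsub hr))
      (fun r hr => hN r (hsub hr)) (fun r hr => hψd r (hsub hr)) (fun r hr => hψ0 r (hsub hr))
      (fun r hr => hanti s hs r (hsub hr) hr.1) (fun r hr => h2 r (hsub hr))
  set A := ∫ s in t₁..t₂, φ s with hA
  set B := ∫ s in t₂..t₃, φ s with hB
  set I := ∫ s in t₁..t₂, F s with hI
  set J := ∫ s in t₂..t₃, F s with hJ
  have hIJ : ∫ s in t₁..t₃, F s = I + J :=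
    (intervalIntegral.integral_add_adjacent_intervals (int hF m1 m2) (int hF m2 m3)).symm
  have hI0 : 0 ≤ I := Fnonneg m1 m2 h12.le
  have hJ0 : 0 ≤ J := Fnonneg m2 m3 h23.le
  have hφ0 : ∀ t ∈ Icc (0 : ℝ) T, 0 < φ t := fun t ht => hφψ t ▸ inv_pos.2 (hψ0 t ht)
  have hA0 : 0 < A := intervalIntegral.intervalIntegral_pos_of_pos_on (int hφc m1 m2)
    (fun t ht => hφ0 t (sub m1 m2 (Ioo_subset_Icc_self ht))) h12
  have hB0 : 0 < B := intervalIntegral.intervalIntegral_pos_of_pos_on (int hφc m2 m3)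
    (fun t ht => hφ0 t (sub m2 m3 (Ioo_subset_Icc_self ht))) h23
  have hM0 : 0 ≤ M := hM ▸ (div_pos hB0 hA0).le
  have hMA : B = M * A := by rw [hM]; field_simp
  have hAle : A * ψ t₂ ≤ t₂ - t₁ := by
    have : A ≤ ∫ _ in t₁..t₂, φ t₂ :=
      intervalIntegral.integral_mono_on h12.le (int hφc m1 m2) (by simp) fun t ht => by
        rw [hφψ, hφψ]
        exact inv_anti₀ (hψ0 _ m2) (hanti t (sub m1 m2 ht) t₂ m2 ht.2)
    rw [intervalIntegral.integral_const, smul_eq_mul, hφψ] at this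
    rwa [← div_eq_mul_inv, le_div_iff₀ (hψ0 _ m2)] at this
  set K := N t₂ * ψ t₂ with hK
  have lower : ∀ t ∈ Icc t₁ t₂, K * φ t - I / 2 ≤ N t := by
    intro t ht
    have mt := sub m1 m2 ht
    have h := gron t mt t₂ m2 ht.2
    have hle : ∫ r in t..t₂, F r ≤ I := by
      have := intervalIntegral.integral_add_adjacent_intervals (int hF m1 mt) (int hF mt m2)
      linarith [Fnonneg m1 mt ht.1]
    have h' := mul_le_mul_of_nonneg_left hle (half_pos (hψ0 t mt)).le
    rw [hφψ, ← div_eq_mul_inv, sub_le_iff_le_add, div_le_iff₀ (hψ0 t mt)]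
    linarith
  have upper : ∀ t ∈ Icc t₂ t₃, N t ≤ (K + ψ t₂ / 2 * J) * φ t := by
    intro t ht
    have mt := sub m2 m3 ht
    have h := gron t₂ m2 t mt ht.1
    have hle : ∫ r in t₂..t, F r ≤ J := by
      have := intervalIntegral.integral_add_adjacent_intervals (int hF m2 mt) (int hF mt m3)
      linarith [Fnonneg mt m3 ht.2]
    have h' := mul_le_mul_of_nonneg_left hle (half_pos (hψ0 t₂ m2)).le
    rw [hφψ, ← div_eq_mul_inv, le_div_iff₀ (hψ0 t mt)]
    linarith
  have hlog : ∀ t ∈ Icc (0 : ℝ) T, HasDerivAt (fun t => Real.log (y t)) (y' t / y t) t :=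
    fun t ht => (hy t ht).log (hypos t ht).ne'
  have hlogR : ∀ t ∈ Icc (0 : ℝ) T,
      HasDerivAt (fun t => C₀ * Real.log (T + ρ - t) - C₁ * t)
        (C₀ * (-1 / (T + ρ - t)) - C₁ * 1) t := fun t ht =>
    ((((hasDerivAt_id t).const_sub (T + ρ)).log (hR t ht).ne').const_mul C₀).sub
      ((hasDerivAt_id t).const_mul C₁)
  have hquot : ∀ t ∈ Icc (0 : ℝ) T,
      |y' t / y t + 2 * N t| ≤ C₀ / (T + ρ - t) + C₁ + F t := by
    intro t ht
    have hp := hypos t ht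
    have e : y' t / y t + 2 * N t = (y' t + 2 * N t * y t) / y t := by field_simp
    rw [e, abs_div, abs_of_pos hp, div_le_iff₀ hp]
    exact h1 t ht
  have left := sub_le_integral_of_hasDerivAt_le (g := fun t => (-2 * K) * φ t + (I + F t)) h12.le
    (fun t ht => (hlog t (sub m1 m2 ht)).add (hlogR t (sub m1 m2 ht)))
    (((continuousOn_const.mul hφc).add (continuousOn_const.add hF)).mono (sub m1 m2))
    (fun t ht => by
      have e1 := (abs_le.1 (hquot t (sub m1 m2 ht))).2
      have e2 := lower t ht
      have e3 : C₀ * (-1 / (T + ρ - t)) = -(C₀ / (T + ρ - t)) := by ring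
      rw [e3]
      linarith)
  have right := sub_le_integral_of_hasDerivAt_le
    (g := fun t => (2 * (K + ψ t₂ / 2 * J)) * φ t + F t) h23.le
    (fun t ht => ((hlog t (sub m2 m3 ht)).neg).add (hlogR t (sub m2 m3 ht)))
    (((continuousOn_const.mul hφc).add hF).mono (sub m2 m3))
    (fun t ht => by
      have e1 := (abs_le.1 (hquot t (sub m2 m3 ht))).1
      have e2 := upper t ht
      have e3 : C₀ * (-1 / (T + ρ - t)) = -(C₀ / (T + ρ - t)) := by ring
      rw [e3]
      linarith)
  rw [intervalIntegral.integral_add ((int hφc m1 m2).const_mul _)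
    ((int continuousOn_const m1 m2).add (int hF m1 m2)), intervalIntegral.integral_const_mul,
    intervalIntegral.integral_add (int continuousOn_const m1 m2) (int hF m1 m2),
    intervalIntegral.integral_const, smul_eq_mul, ← hA, ← hI] at left
  rw [intervalIntegral.integral_add ((int hφc m2 m3).const_mul _) (int hF m2 m3),
    intervalIntegral.integral_const_mul, ← hB, ← hJ] at right
  simp only [Pi.add_apply, Pi.neg_apply] at left right
  have r1 := hR t₁ m1
  have r3 := hR t₃ m3
  have y1 := hypos t₁ m1
  have y2 := hypos t₂ m2
  have y3 := hypos t₃ m3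
  have l12 : Real.log (T + ρ - t₂) ≤ Real.log (T + ρ - t₁) :=
    Real.log_le_log (hR t₂ m2) (by linarith)
  have l23 : Real.log (T + ρ - t₃) ≤ Real.log (T + ρ - t₂) :=
    Real.log_le_log r3 (by linarith)
  rw [Real.rpow_def_of_pos y2, Real.rpow_def_of_pos (div_pos r1 r3), Real.rpow_def_of_pos y1,
    Real.log_div r1.ne' r3.ne']
  rw [← Real.exp_log y3, ← Real.exp_add, ← Real.exp_add, ← Real.exp_add, Real.exp_le_exp, hG, hIJ]
  rw [hMA] at right
  have b1 := mul_le_mul_of_nonneg_left left hM0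
  have b2 := mul_le_mul_of_nonneg_left hAle (mul_nonneg hM0 hJ0)
  have b3 : 0 ≤ M * C₀ * (Real.log (T + ρ - t₂) - Real.log (T + ρ - t₃)) :=
    mul_nonneg (mul_nonneg hM0 hC₀) (sub_nonneg.2 l23)
  have b4 : 0 ≤ C₀ * (Real.log (T + ρ - t₁) - Real.log (T + ρ - t₂)) :=
    mul_nonneg hC₀ (sub_nonneg.2 l12)
  have b5 : 0 ≤ M * C₁ * (t₃ - t₂) := mul_nonneg (mul_nonneg hM0 hC₁) (by linarith)
  have b6 : 0 ≤ C₁ * (t₂ - t₁) := mul_nonneg hC₁ (by linarith)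
  have b7 : 0 ≤ M * (t₃ - t₂) * (I + J) :=
    mul_nonneg (mul_nonneg hM0 (by linarith)) (by linarith)
  have b8 : 0 ≤ (t₃ - t₁) * (I + J) := mul_nonneg (by linarith) (by linarith)
  have b9 : 0 ≤ M * J := mul_nonneg hM0 hJ0
  linarith
end

section
/- Let T > 0, ρ > 0, C₀ ≥ 0, C₁ ≥ 0, let F : [0,T] → ℝ be continuous and nonnegative, and let y, N : [0,T] → ℝ be positive C¹ functions satisfying, for all t ∈ [0,T], | y′(t) + 2N(t)y(t) | ≤ ( C₀/(T − t + ρ) + C₁ + F(t) ) y(t) and N′(t) ≤ ( (1 + C₀)/(T − t + ρ) + C₁ ) N(t) + F(t)/2. Let ℓ > 1 satisfy ℓρ ≤ min{1/2, T/4}. Then y(T − ℓρ)^{1+M_ℓ} ≤ e^{G_ℓ} (1 + 2ℓ)^{2C₀(1+M_ℓ)} y(T) · y(T − 2ℓρ)^{M_ℓ}, where M_ℓ := ( ∫_{T−ℓρ}^{T} e^{C₁ s}/(T − s + ρ)^{1+C₀} ds ) / ( ∫_{T−2ℓρ}^{T−ℓρ} e^{C₁ s}/(T − s + ρ)^{1+C₀}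 ds ) and G_ℓ := (1+M_ℓ)( 2∫_{T−2ℓρ}^{T} F(s) ds + C₁ ). Moreover M_ℓ ≤ S_ℓ, where S_ℓ := e^{C₁} · ln(1+ℓ)/ln(3/2) if C₀ = 0 and S_ℓ := e^{C₁} (1+ℓ)^{C₀}/(1 − (2/3)^{C₀}) if C₀ > 0. -/
open MeasureTheory intervalIntegral Set

/-- If `w' = w * b` and `N' ≤ b N + F / 2` with `w` positive and monotone, then `N / w` grows at
most by `(∫ F) / (2 w(s))` from `s` on. -/
lemma div_weight_le {s r : ℝ} (hsr : s ≤ r) {w b N N' F : ℝ → ℝ}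
    (hw0 : ∀ t ∈ Icc s r, 0 < w t) (hwm : MonotoneOn w (Icc s r))
    (hw : ∀ t ∈ Icc s r, HasDerivAt w (w t * b t) t) (hb : ContinuousOn b (Icc s r))
    (hF : ContinuousOn F (Icc s r)) (hF0 : ∀ t ∈ Icc s r, 0 ≤ F t)
    (hN : ∀ t ∈ Icc s r, HasDerivAt N (N' t) t) (hN' : ContinuousOn N' (Icc s r))
    (h : ∀ t ∈ Icc s r, N' t ≤ b t * N t + F t / 2) :
    N r / w r ≤ N s / w s + (∫ t in s..r, F t) / (2 * w s) := by
  have hwc : ContinuousOn w (Icc s r) := fun t ht => (hw t ht).continuousAt.continuousWithinAt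
  have hNc : ContinuousOn N (Icc s r) := fun t ht => (hN t ht).continuousAt.continuousWithinAt
  have hD : ∀ t ∈ Icc s r,
      HasDerivAt (fun t => N t / w t) ((N' t * w t - N t * (w t * b t)) / w t ^ 2) t :=
    fun t ht => (hN t ht).div (hw t ht) (hw0 t ht).ne'
  have hDc : ContinuousOn (fun t => (N' t * w t - N t * (w t * b t)) / w t ^ 2) (Icc s r) :=
    ((hN'.mul hwc).sub (hNc.mul (hwc.mul hb))).div (hwc.pow 2)
      fun t ht => (pow_pos (hw0 t ht) 2).ne'
  have hDi : IntervalIntegrable (fun t => (N' t * w t - N t * (w t * b t)) / w t ^ 2) volume s r :=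
    hDc.intervalIntegrable_of_Icc hsr
  have hFi : IntervalIntegrable F volume s r := hF.intervalIntegrable_of_Icc hsr
  have hs : s ∈ Icc s r := left_mem_Icc.2 hsr
  have key : N r / w r - N s / w s ≤ ∫ t in s..r, F t / (2 * w s) := by
    rw [← integral_eq_sub_of_hasDerivAt (f := fun t => N t / w t) (by rwa [uIcc_of_le hsr]) hDi]
    refine integral_mono_on hsr hDi (hFi.div_const _) fun t ht => ?_
    have hwt := hw0 t ht
    calc (N' t * w t - N t * (w t * b t)) / w t ^ 2 = (N' t - b t * N t) / w t := by
          field_simp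
      _ ≤ (F t / 2) / w t := by gcongr; linarith [h t ht]
      _ ≤ (F t / 2) / w s := div_le_div_of_nonneg_left (by linarith [hF0 t ht]) (hw0 s hs)
          (hwm hs ht ht.1)
      _ = F t / (2 * w s) := by rw [div_div]
  rw [intervalIntegral.integral_div] at key
  linarith

/-- The ODE lemma of the logarithmic convexity method: a three-point interpolation inequality for
`log y` along `t₁ < t₂ < t₃`. -/
lemma log_convexity_three_points {t₁ t₂ t₃ : ℝ} (h12 : t₁ < t₂) (h23 : t₂ ≤ t₃)
    {w a b F y N y' N' : ℝ → ℝ}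
    (hw0 : ∀ t ∈ Icc t₁ t₃, 0 < w t) (hwm : MonotoneOn w (Icc t₁ t₃))
    (hw : ∀ t ∈ Icc t₁ t₃, HasDerivAt w (w t * b t) t) (hb : ContinuousOn b (Icc t₁ t₃))
    (ha : ContinuousOn a (Icc t₁ t₃)) (ha0 : ∀ t ∈ Icc t₁ t₃, 0 ≤ a t)
    (hF : ContinuousOn F (Icc t₁ t₃)) (hF0 : ∀ t ∈ Icc t₁ t₃, 0 ≤ F t)
    (hy0 : ∀ t ∈ Icc t₁ t₃, 0 < y t)
    (hy : ∀ t ∈ Icc t₁ t₃, HasDerivAt y (y' t) t) (hy' : ContinuousOn y' (Icc t₁ t₃))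
    (hN : ∀ t ∈ Icc t₁ t₃, HasDerivAt N (N' t) t) (hN' : ContinuousOn N' (Icc t₁ t₃))
    (h1 : ∀ t ∈ Icc t₁ t₃, |y' t + 2 * N t * y t| ≤ a t * y t)
    (h2 : ∀ t ∈ Icc t₁ t₃, N' t ≤ b t * N t + F t / 2)
    {M : ℝ} (hM : M = (∫ t in t₂..t₃, w t) / ∫ t in t₁..t₂, w t) :
    0 ≤ M ∧ (1 + M) * Real.log (y t₂) ≤ Real.log (y t₃) + M * Real.log (y t₁)
      + (1 + M) * (∫ t in t₁..t₃, a t) + M * (t₂ - t₁) * ∫ t in t₁..t₃, F t := by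
  have hsub1 : Icc t₁ t₂ ⊆ Icc t₁ t₃ := Icc_subset_Icc_right h23
  have hsub2 : Icc t₂ t₃ ⊆ Icc t₁ t₃ := Icc_subset_Icc_left h12.le
  have m2 : t₂ ∈ Icc t₁ t₃ := ⟨h12.le, h23⟩
  have hwc : ContinuousOn w (Icc t₁ t₃) := fun t ht => (hw t ht).continuousAt.continuousWithinAt
  have hyc : ContinuousOn y (Icc t₁ t₃) := fun t ht => (hy t ht).continuousAt.continuousWithinAt
  have hLc : ContinuousOn (fun t => y' t / y t) (Icc t₁ t₃) :=
    hy'.div hyc fun t ht => (hy0 t ht).ne'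
  have int1 {f : ℝ → ℝ} (hf : ContinuousOn f (Icc t₁ t₃)) : IntervalIntegrable f volume t₁ t₂ :=
    (hf.mono hsub1).intervalIntegrable_of_Icc h12.le
  have int2 {f : ℝ → ℝ} (hf : ContinuousOn f (Icc t₁ t₃)) : IntervalIntegrable f volume t₂ t₃ :=
    (hf.mono hsub2).intervalIntegrable_of_Icc h23
  have hlog : ∀ t ∈ Icc t₁ t₃, HasDerivAt (fun t => Real.log (y t)) (y' t / y t) t :=
    fun t ht => (hy t ht).log (hy0 t ht).ne'
  have hW1 : 0 < ∫ t in t₁..t₂, w t :=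
    intervalIntegral_pos_of_pos_on (int1 hwc)
      (fun t ht => hw0 t (hsub1 (Ioo_subset_Icc_self ht))) h12
  have hW2 : 0 ≤ ∫ t in t₂..t₃, w t :=
    integral_nonneg h23 fun t ht => (hw0 t (hsub2 ht)).le
  have hF1 : 0 ≤ ∫ t in t₁..t₂, F t := integral_nonneg h12.le fun t ht => hF0 t (hsub1 ht)
  have hF2 : 0 ≤ ∫ t in t₂..t₃, F t := integral_nonneg h23 fun t ht => hF0 t (hsub2 ht)
  have ha1 : 0 ≤ ∫ t in t₁..t₂, a t := integral_nonneg h12.le fun t ht => ha0 t (hsub1 ht)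
  have ha2 : 0 ≤ ∫ t in t₂..t₃, a t := integral_nonneg h23 fun t ht => ha0 t (hsub2 ht)
  have hM0 : 0 ≤ M := hM ▸ div_nonneg hW2 hW1.le
  have hMW : M * (∫ t in t₁..t₂, w t) = ∫ t in t₂..t₃, w t := by
    rw [hM, div_mul_cancel₀ _ hW1.ne']
  have hW1le : (∫ t in t₁..t₂, w t) ≤ (t₂ - t₁) * w t₂ := by
    have := integral_mono_on (g := fun _ => w t₂) h12.le (int1 hwc) intervalIntegrable_const
      fun t ht => hwm (hsub1 ht) m2 ht.2
    simpa using this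
  have hsplita := integral_add_adjacent_intervals (int1 ha) (int2 ha)
  have hsplitF := integral_add_adjacent_intervals (int1 hF) (int2 hF)
  have hgrowth {s r : ℝ} (hsr : s ≤ r) (hsub : Icc s r ⊆ Icc t₁ t₃) :
      N r / w r ≤ N s / w s + (∫ t in s..r, F t) / (2 * w s) :=
    div_weight_le hsr (fun t ht => hw0 t (hsub ht)) (hwm.mono hsub) (fun t ht => hw t (hsub ht))
      (hb.mono hsub) (hF.mono hsub) (fun t ht => hF0 t (hsub ht)) (fun t ht => hN t (hsub ht))
      (hN'.mono hsub) (fun t ht => h2 t (hsub ht))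
  set κ := N t₂ / w t₂ with hκ
  have hleft : Real.log (y t₂) - Real.log (y t₁) ≤ -2 * κ * (∫ t in t₁..t₂, w t)
      + (t₂ - t₁) * (∫ t in t₁..t₂, F t) + ∫ t in t₁..t₂, a t := by
    have hE : (∫ t in t₁..t₂, (-2 * κ * w t + (∫ r in t₁..t₂, F r) + a t))
        = -2 * κ * (∫ t in t₁..t₂, w t) + (t₂ - t₁) * (∫ t in t₁..t₂, F t)
          + ∫ t in t₁..t₂, a t := by
      rw [intervalIntegral.integral_add (((int1 hwc).const_mul _).add intervalIntegrable_const)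
        (int1 ha), intervalIntegral.integral_add ((int1 hwc).const_mul _) intervalIntegrable_const,
        intervalIntegral.integral_const_mul, intervalIntegral.integral_const, smul_eq_mul]
    rw [← hE, ← integral_eq_sub_of_hasDerivAt (f := fun t => Real.log (y t))
      (fun t ht => hlog t (hsub1 (uIcc_of_le h12.le ▸ ht))) (int1 hLc)]
    refine integral_mono_on h12.le (int1 hLc)
      ((((int1 hwc).const_mul _).add intervalIntegrable_const).add (int1 ha)) fun t ht => ?_
    have hwt := hw0 t (hsub1 ht)
    have hg := hgrowth ht.2 (Icc_subset_Icc ht.1 h23)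
    have hFt : (∫ r in t..t₂, F r) ≤ ∫ r in t₁..t₂, F r := by
      have hcont : ContinuousOn F (Icc t₁ t) :=
        hF.mono (Icc_subset_Icc_right (ht.2.trans h23))
      have := integral_add_adjacent_intervals (hcont.intervalIntegrable_of_Icc (μ := volume) ht.1)
        ((hF.mono (Icc_subset_Icc ht.1 h23)).intervalIntegrable_of_Icc ht.2)
      have h0 : 0 ≤ ∫ r in t₁..t, F r :=
        integral_nonneg ht.1 fun r hr => hF0 r ⟨hr.1, hr.2.trans (ht.2.trans h23)⟩
      linarith
    have hNt : κ * w t ≤ N t + (∫ r in t₁..t₂, F r) / 2 := by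
      calc κ * w t ≤ (N t / w t + (∫ r in t..t₂, F r) / (2 * w t)) * w t := by gcongr
        _ = N t + (∫ r in t..t₂, F r) / 2 := by field_simp
        _ ≤ _ := by gcongr
    have hyt := hy0 t (hsub1 ht)
    have := (abs_le.1 (h1 t (hsub1 ht))).2
    have hy2 : y' t / y t ≤ a t - 2 * N t := by
      rw [div_le_iff₀ hyt]; linarith
    linarith
  have hright : -2 * κ * (∫ t in t₂..t₃, w t)
      - (∫ t in t₂..t₃, F t) / w t₂ * (∫ t in t₂..t₃, w t) - (∫ t in t₂..t₃, a t)
      ≤ Real.log (y t₃) - Real.log (y t₂) := by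
    have hE : (∫ t in t₂..t₃, ((-2 * κ - (∫ t in t₂..t₃, F t) / w t₂) * w t - a t))
        = -2 * κ * (∫ t in t₂..t₃, w t)
          - (∫ t in t₂..t₃, F t) / w t₂ * (∫ t in t₂..t₃, w t) - ∫ t in t₂..t₃, a t := by
      rw [intervalIntegral.integral_sub ((int2 hwc).const_mul _) (int2 ha),
        intervalIntegral.integral_const_mul]
      ring
    rw [← hE, ← integral_eq_sub_of_hasDerivAt (f := fun t => Real.log (y t))
      (fun t ht => hlog t (hsub2 (uIcc_of_le h23 ▸ ht))) (int2 hLc)]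
    refine integral_mono_on h23 (((int2 hwc).const_mul _).sub (int2 ha)) (int2 hLc) fun t ht => ?_
    have hwt := hw0 t (hsub2 ht)
    have hw2 := hw0 t₂ m2
    have hg := hgrowth ht.1 (Icc_subset_Icc h12.le ht.2)
    have hFt : (∫ r in t₂..t, F r) ≤ ∫ r in t₂..t₃, F r := by
      have hcont : ContinuousOn F (Icc t₂ t) := hF.mono (Icc_subset_Icc h12.le ht.2)
      have := integral_add_adjacent_intervals (hcont.intervalIntegrable_of_Icc (μ := volume) ht.1)
        ((hF.mono (Icc_subset_Icc_left (h12.le.trans ht.1))).intervalIntegrable_of_Icc ht.2)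
      have h0 : 0 ≤ ∫ r in t..t₃, F r :=
        integral_nonneg ht.2 fun r hr => hF0 r ⟨h12.le.trans (ht.1.trans hr.1), hr.2⟩
      linarith
    have hNt : 2 * N t ≤ (2 * κ + (∫ r in t₂..t₃, F r) / w t₂) * w t := by
      calc 2 * N t = 2 * (N t / w t) * w t := by field_simp
        _ ≤ 2 * (κ + (∫ r in t₂..t, F r) / (2 * w t₂)) * w t := by gcongr
        _ ≤ 2 * (κ + (∫ r in t₂..t₃, F r) / (2 * w t₂)) * w t := by gcongr
        _ = _ := by field_simp
    have hyt := hy0 t (hsub2 ht)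
    have := (abs_le.1 (h1 t (hsub2 ht))).1
    have hy2 : -a t - 2 * N t ≤ y' t / y t := by
      rw [le_div_iff₀ hyt]; linarith
    linarith
  have hloss : (∫ t in t₂..t₃, F t) / w t₂ * (∫ t in t₂..t₃, w t)
      ≤ M * (t₂ - t₁) * ∫ t in t₂..t₃, F t := by
    have hw2 := hw0 t₂ m2
    rw [← hMW]
    calc _ ≤ (∫ t in t₂..t₃, F t) / w t₂ * (M * ((t₂ - t₁) * w t₂)) := by gcongr
      _ = _ := by field_simp
  refine ⟨hM0, ?_⟩
  have hleftM := mul_le_mul_of_nonneg_left hleft hM0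
  have hMa := mul_nonneg hM0 ha2
  rw [← hsplita, ← hsplitF]
  linear_combination hleftM + hright + hloss + hMa + ha1 - 2 * κ * hMW

/-- The integral of `(T - s + ρ)⁻¹`. -/
lemma integral_inv_sub_add {T ρ p q : ℝ} (hpq : p ≤ q) (hq : q < T + ρ) :
    ∫ s in p..q, (T - s + ρ)⁻¹ = Real.log ((T - p + ρ) / (T - q + ρ)) := by
  have hpos : ∀ s ∈ uIcc p q, 0 < T - s + ρ := fun s hs => by
    rw [uIcc_of_le hpq] at hs; linarith [hs.2]
  have hd : ∀ s ∈ uIcc p q, HasDerivAt (fun s => -Real.log (T - s + ρ)) (T - s + ρ)⁻¹ s :=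
    fun s hs => by
      have hb : HasDerivAt (fun s => T - s + ρ) (-1) s :=
        ((hasDerivAt_id s).const_sub T).add_const ρ
      exact (hb.log (hpos s hs).ne').neg.congr_deriv (by rw [neg_div, neg_neg, one_div])
  rw [integral_eq_sub_of_hasDerivAt hd, Real.log_div (hpos p left_mem_uIcc).ne'
    (hpos q right_mem_uIcc).ne']
  · ring
  · exact ContinuousOn.intervalIntegrable
      (ContinuousOn.inv₀ (by fun_prop) fun s hs => (hpos s hs).ne')

/-- The integral of `(T - s + ρ) ^ (-(1 + c))` for `c ≠ 0`. -/
lemma integral_inv_rpow_sub_add {T ρ p q c : ℝ} (hpq : p ≤ q) (hq : q < T + ρ) (hc : c ≠ 0) :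
    ∫ s in p..q, ((T - s + ρ) ^ (1 + c))⁻¹
      = ((T - q + ρ) ^ (-c) - (T - p + ρ) ^ (-c)) / c := by
  have hpos : ∀ s ∈ uIcc p q, 0 < T - s + ρ := fun s hs => by
    rw [uIcc_of_le hpq] at hs; linarith [hs.2]
  have hd : ∀ s ∈ uIcc p q,
      HasDerivAt (fun s => (T - s + ρ) ^ (-c) / c) ((T - s + ρ) ^ (1 + c))⁻¹ s := fun s hs => by
    have hb : HasDerivAt (fun s => T - s + ρ) (-1) s :=
      ((hasDerivAt_id s).const_sub T).add_const ρ
    refine ((hb.rpow_const (p := -c) (Or.inl (hpos s hs).ne')).div_const c).congr_deriv ?_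
    rw [← Real.rpow_neg (hpos s hs).le, show -(1 + c) = -c - 1 by ring]
    field_simp
  rw [integral_eq_sub_of_hasDerivAt hd]
  · ring
  · refine ContinuousOn.intervalIntegrable (ContinuousOn.inv₀ ?_ fun s hs =>
      (Real.rpow_pos_of_pos (hpos s hs) _).ne')
    exact ContinuousOn.rpow_const (by fun_prop) fun s hs => Or.inl (hpos s hs).ne'

/-- The exponential factor distorts the ratio of consecutive integrals by at most
`exp (C₁ (q - p))`. -/
lemma integral_exp_mul_div_le {p m q C₁ : ℝ} (hpm : p < m) (hmq : m ≤ q) (hC₁ : 0 ≤ C₁)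
    {v : ℝ → ℝ} (hv : ContinuousOn v (Icc p q)) (hv0 : ∀ s ∈ Icc p q, 0 < v s) :
    (∫ s in m..q, Real.exp (C₁ * s) / v s) / (∫ s in p..m, Real.exp (C₁ * s) / v s)
      ≤ Real.exp (C₁ * (q - p)) * ((∫ s in m..q, (v s)⁻¹) / ∫ s in p..m, (v s)⁻¹) := by
  have hsub1 : Icc p m ⊆ Icc p q := Icc_subset_Icc_right hmq
  have hsub2 : Icc m q ⊆ Icc p q := Icc_subset_Icc_left hpm.le
  have hvi : ContinuousOn (fun s => (v s)⁻¹) (Icc p q) := hv.inv₀ fun s hs => (hv0 s hs).ne'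
  have hvw : ContinuousOn (fun s => Real.exp (C₁ * s) / v s) (Icc p q) :=
    ContinuousOn.div (by fun_prop) hv fun s hs => (hv0 s hs).ne'
  have hnum : (∫ s in m..q, Real.exp (C₁ * s) / v s)
      ≤ Real.exp (C₁ * q) * ∫ s in m..q, (v s)⁻¹ := by
    rw [← intervalIntegral.integral_const_mul]
    refine integral_mono_on hmq ((hvw.mono hsub2).intervalIntegrable_of_Icc hmq)
      (((hvi.mono hsub2).intervalIntegrable_of_Icc hmq).const_mul _) fun s hs => ?_
    have := hv0 s (hsub2 hs)
    rw [div_eq_mul_inv]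
    gcongr
    exact hs.2
  have hden : Real.exp (C₁ * p) * (∫ s in p..m, (v s)⁻¹)
      ≤ ∫ s in p..m, Real.exp (C₁ * s) / v s := by
    rw [← intervalIntegral.integral_const_mul]
    refine integral_mono_on hpm.le (((hvi.mono hsub1).intervalIntegrable_of_Icc hpm.le).const_mul _)
      ((hvw.mono hsub1).intervalIntegrable_of_Icc hpm.le) fun s hs => ?_
    have := hv0 s (hsub1 hs)
    rw [div_eq_mul_inv]
    gcongr
    exact hs.1
  have hpos : 0 < ∫ s in p..m, (v s)⁻¹ :=
    intervalIntegral_pos_of_pos_on ((hvi.mono hsub1).intervalIntegrable_of_Icc hpm.le)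
      (fun s hs => inv_pos.2 (hv0 s (hsub1 (Ioo_subset_Icc_self hs)))) hpm
  have hnn : 0 ≤ ∫ s in m..q, (v s)⁻¹ :=
    integral_nonneg hmq fun s hs => (inv_pos.2 (hv0 s (hsub2 hs))).le
  calc _ ≤ (Real.exp (C₁ * q) * ∫ s in m..q, (v s)⁻¹)
        / (Real.exp (C₁ * p) * ∫ s in p..m, (v s)⁻¹) := by gcongr
    _ = _ := by
      rw [mul_sub, Real.exp_sub]
      field_simp

/-- The uniform bound on the quotient of the integrals of `(T - s + ρ) ^ (-(1 + C₀))`. -/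
lemma integral_inv_rpow_ratio_le {T ρ C₀ ℓ : ℝ} (hρ : 0 < ρ) (hC₀ : 0 ≤ C₀) (hℓ : 1 < ℓ) :
    (∫ s in (T - ℓ * ρ)..T, ((T - s + ρ) ^ (1 + C₀))⁻¹)
      / (∫ s in (T - 2 * ℓ * ρ)..(T - ℓ * ρ), ((T - s + ρ) ^ (1 + C₀))⁻¹)
      ≤ if C₀ = 0 then Real.log (1 + ℓ) / Real.log (3 / 2)
        else (1 + ℓ) ^ C₀ / (1 - (2 / 3 : ℝ) ^ C₀) := by
  have hℓρ : 0 < ℓ * ρ := by positivity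
  have e1 : T - (T - 2 * ℓ * ρ) + ρ = ρ * (1 + 2 * ℓ) := by ring
  have e2 : T - (T - ℓ * ρ) + ρ = ρ * (1 + ℓ) := by ring
  have e3 : T - T + ρ = ρ := by ring
  split_ifs with h0
  · subst h0
    simp only [add_zero, Real.rpow_one]
    rw [integral_inv_sub_add (by linarith) (by linarith),
      integral_inv_sub_add (by linarith) (by linarith), e1, e2, e3,
      mul_div_cancel_left₀ _ hρ.ne', mul_div_mul_left _ _ hρ.ne']
    have hlog : 0 < Real.log (3 / 2) := Real.log_pos (by norm_num)
    have hlog2 : 0 ≤ Real.log (1 + ℓ) := Real.log_nonneg (by linarith)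
    have hquot : 3 / 2 ≤ (1 + 2 * ℓ) / (1 + ℓ) := by
      rw [le_div_iff₀ (by linarith)]
      linarith
    exact div_le_div_of_nonneg_left hlog2 hlog (Real.log_le_log (by norm_num) hquot)
  · have hC : 0 < C₀ := lt_of_le_of_ne hC₀ (Ne.symm h0)
    rw [integral_inv_rpow_sub_add (by linarith) (by linarith) h0,
      integral_inv_rpow_sub_add (by linarith) (by linarith) h0, e1, e2, e3,
      div_div_div_cancel_right₀ h0]
    have hr : 0 < ρ ^ (-C₀) := Real.rpow_pos_of_pos hρ _
    have hl : 0 < (1 + ℓ) ^ (-C₀) := Real.rpow_pos_of_pos (by linarith) _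
    have h23 : (2 / 3 : ℝ) ^ C₀ < 1 := Real.rpow_lt_one (by norm_num) (by norm_num) hC
    have hden : ρ ^ (-C₀) * (1 + ℓ) ^ (-C₀) * (1 - (2 / 3 : ℝ) ^ C₀)
        ≤ (ρ * (1 + ℓ)) ^ (-C₀) - (ρ * (1 + 2 * ℓ)) ^ (-C₀) := by
      have hcmp : (1 + 2 * ℓ) ^ (-C₀) ≤ (1 + ℓ) ^ (-C₀) * (2 / 3 : ℝ) ^ C₀ := by
        have : (2 / 3 : ℝ) ^ C₀ = (3 / 2 : ℝ) ^ (-C₀) := by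
          rw [Real.rpow_neg (by norm_num), ← Real.inv_rpow (by norm_num)]
          norm_num
        rw [this, ← Real.mul_rpow (by linarith) (by norm_num)]
        exact Real.rpow_le_rpow_of_nonpos (by linarith) (by linarith) (by linarith)
      rw [Real.mul_rpow hρ.le (by linarith), Real.mul_rpow hρ.le (by linarith)]
      linear_combination ρ ^ (-C₀) * hcmp
    have hnum : ρ ^ (-C₀) - (ρ * (1 + ℓ)) ^ (-C₀) ≤ ρ ^ (-C₀) :=
      sub_le_self _ (Real.rpow_nonneg (by positivity) _)
    calc _ ≤ ρ ^ (-C₀) / (ρ ^ (-C₀) * (1 + ℓ) ^ (-C₀) * (1 - (2 / 3 : ℝ) ^ C₀)) :=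
          div_le_div₀ hr.le hnum (mul_pos (mul_pos hr hl) (by linarith)) hden
      _ = (1 + ℓ) ^ C₀ / (1 - (2 / 3 : ℝ) ^ C₀) := by
        have h1 : 1 - (2 / 3 : ℝ) ^ C₀ ≠ 0 := by linarith
        rw [Real.rpow_neg (by linarith : 0 ≤ 1 + ℓ)]
        have h2 : (1 + ℓ) ^ C₀ ≠ 0 := (Real.rpow_pos_of_pos (by linarith) _).ne'
        field_simp

/-- The logarithmic derivative of the weight `exp (C₁ s) / (T - s + ρ) ^ (1 + C₀)`. -/
lemma hasDerivAt_exp_div_rpow {T ρ C₀ C₁ t : ℝ} (ht : 0 < T - t + ρ) :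
    HasDerivAt (fun s => Real.exp (C₁ * s) / (T - s + ρ) ^ (1 + C₀))
      (Real.exp (C₁ * t) / (T - t + ρ) ^ (1 + C₀) * ((1 + C₀) / (T - t + ρ) + C₁)) t := by
  have hb : HasDerivAt (fun s => T - s + ρ) (-1) t :=
    ((hasDerivAt_id t).const_sub T).add_const ρ
  have he : HasDerivAt (fun s => Real.exp (C₁ * s)) (Real.exp (C₁ * t) * (C₁ * 1)) t :=
    ((hasDerivAt_id t).const_mul C₁).exp
  have hp : (T - t + ρ) ^ (1 + C₀) ≠ 0 := (Real.rpow_pos_of_pos ht _).ne'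
  refine (he.div (hb.rpow_const (p := 1 + C₀) (Or.inl ht.ne')) hp).congr_deriv ?_
  have hsub : (T - t + ρ) ^ (1 + C₀ - 1) = (T - t + ρ) ^ (1 + C₀) / (T - t + ρ) :=
    Real.rpow_sub_one ht.ne' _
  rw [hsub]
  field_simp
  ring

/-- Specialization of the ODE lemma of the logarithmic convexity method to the times
`t₁ = T − 2ℓρ`, `t₂ = T − ℓρ`, `t₃ = T`, together with the explicit uniform bound
`M_ℓ ≤ S_ℓ` on the interpolation exponent. -/
theorem log_convexity_ode_specialized
    (T ρ C₀ C₁ : ℝ) (hT : 0 < T) (hρ : 0 < ρ) (hC₀ : 0 ≤ C₀) (hC₁ : 0 ≤ C₁)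
    (F y N y' N' : ℝ → ℝ)
    (hF : ContinuousOn F (Set.Icc 0 T)) (hFpos : ∀ t ∈ Set.Icc (0 : ℝ) T, 0 ≤ F t)
    (hypos : ∀ t ∈ Set.Icc (0 : ℝ) T, 0 < y t) (hNpos : ∀ t ∈ Set.Icc (0 : ℝ) T, 0 < N t)
    (hy : ∀ t ∈ Set.Icc (0 : ℝ) T, HasDerivAt y (y' t) t)
    (hN : ∀ t ∈ Set.Icc (0 : ℝ) T, HasDerivAt N (N' t) t)
    (hy' : ContinuousOn y' (Set.Icc 0 T)) (hN' : ContinuousOn N' (Set.Icc 0 T))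
    (h1 : ∀ t ∈ Set.Icc (0 : ℝ) T,
      |y' t + 2 * N t * y t| ≤ (C₀ / (T - t + ρ) + C₁ + F t) * y t)
    (h2 : ∀ t ∈ Set.Icc (0 : ℝ) T,
      N' t ≤ ((1 + C₀) / (T - t + ρ) + C₁) * N t + F t / 2)
    (ℓ : ℝ) (hℓ : 1 < ℓ) (hℓρ : ℓ * ρ ≤ min (1 / 2) (T / 4))
    (Mℓ Gℓ Sℓ : ℝ)
    (hMℓ : Mℓ = (∫ s in (T - ℓ * ρ)..T, Real.exp (C₁ * s) / (T - s + ρ) ^ (1 + C₀)) /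
                (∫ s in (T - 2 * ℓ * ρ)..(T - ℓ * ρ),
                  Real.exp (C₁ * s) / (T - s + ρ) ^ (1 + C₀)))
    (hGℓ : Gℓ = (1 + Mℓ) * (2 * (∫ s in (T - 2 * ℓ * ρ)..T, F s) + C₁))
    (hSℓ : Sℓ = if C₀ = 0 then Real.exp C₁ * Real.log (1 + ℓ) / Real.log (3 / 2)
                else Real.exp C₁ * (1 + ℓ) ^ C₀ / (1 - (2 / 3 : ℝ) ^ C₀)) :
    y (T - ℓ * ρ) ^ (1 + Mℓ) ≤
      Real.exp Gℓ * (1 + 2 * ℓ) ^ (2 * C₀ * (1 + Mℓ)) * y T * y (T - 2 * ℓ * ρ) ^ Mℓ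
    ∧ Mℓ ≤ Sℓ := by
  obtain ⟨hhalf, hquarter⟩ := le_min_iff.1 hℓρ
  have hℓρ0 : 0 < ℓ * ρ := by positivity
  have hsub : Icc (T - 2 * ℓ * ρ) T ⊆ Icc 0 T := Icc_subset_Icc_left (by linarith)
  have hpos : ∀ t ∈ Icc (T - 2 * ℓ * ρ) T, 0 < T - t + ρ := fun t ht => by linarith [ht.2]
  have hden : ContinuousOn (fun t => T - t + ρ) (Icc (T - 2 * ℓ * ρ) T) := by fun_prop
  constructor
  · have hquot (c : ℝ) : ContinuousOn (fun t => c / (T - t + ρ)) (Icc (T - 2 * ℓ * ρ) T) :=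
      continuousOn_const.div hden fun t ht => (hpos t ht).ne'
    have hwm : MonotoneOn (fun s => Real.exp (C₁ * s) / (T - s + ρ) ^ (1 + C₀))
        (Icc (T - 2 * ℓ * ρ) T) := fun s hs t ht hst => by
      have := hpos t ht
      dsimp only
      gcongr
    have hF' := hF.mono hsub
    have hle : T - 2 * ℓ * ρ ≤ T := by linarith
    obtain ⟨hM0, hmain⟩ := log_convexity_three_points (t₁ := T - 2 * ℓ * ρ) (t₂ := T - ℓ * ρ)
      (t₃ := T) (w := fun s => Real.exp (C₁ * s) / (T - s + ρ) ^ (1 + C₀))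
      (a := fun t => C₀ / (T - t + ρ) + C₁ + F t) (by linarith) (by linarith)
      (fun t ht => div_pos (Real.exp_pos _) (Real.rpow_pos_of_pos (hpos t ht) _)) hwm
      (fun t ht => hasDerivAt_exp_div_rpow (hpos t ht))
      ((hquot _).add continuousOn_const) (((hquot _).add continuousOn_const).add hF')
      (fun t ht => add_nonneg (add_nonneg (div_nonneg hC₀ (hpos t ht).le) hC₁)
        (hFpos t (hsub ht)))
      hF' (fun t ht => hFpos t (hsub ht)) (fun t ht => hypos t (hsub ht))
      (fun t ht => hy t (hsub ht)) (hy'.mono hsub) (fun t ht => hN t (hsub ht)) (hN'.mono hsub)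
      (fun t ht => h1 t (hsub ht)) (fun t ht => h2 t (hsub ht)) hMℓ
    have hFi : IntervalIntegrable F volume (T - 2 * ℓ * ρ) T := hF'.intervalIntegrable_of_Icc hle
    have hqi : IntervalIntegrable (fun t => C₀ / (T - t + ρ)) volume (T - 2 * ℓ * ρ) T :=
      (hquot _).intervalIntegrable_of_Icc hle
    have hJ : 0 ≤ ∫ t in (T - 2 * ℓ * ρ)..T, F t :=
      integral_nonneg hle fun t ht => hFpos t (hsub ht)
    have hA : (∫ t in (T - 2 * ℓ * ρ)..T, (C₀ / (T - t + ρ) + C₁ + F t))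
        = C₀ * Real.log (1 + 2 * ℓ) + 2 * (ℓ * ρ) * C₁ + ∫ t in (T - 2 * ℓ * ρ)..T, F t := by
      rw [intervalIntegral.integral_add (hqi.add intervalIntegrable_const) hFi,
        intervalIntegral.integral_add hqi intervalIntegrable_const,
        intervalIntegral.integral_const, smul_eq_mul]
      simp only [div_eq_mul_inv]
      rw [intervalIntegral.integral_const_mul, integral_inv_sub_add hle (by linarith),
        show (T - (T - 2 * ℓ * ρ) + ρ) / (T - T + ρ) = 1 + 2 * ℓ by
          rw [div_eq_iff (by linarith)]; ring]
      ring
    rw [hA] at hmain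
    have hy1 := hypos (T - 2 * ℓ * ρ) (hsub (left_mem_Icc.2 hle))
    have hy2 := hypos (T - ℓ * ρ) (hsub ⟨by linarith, by linarith⟩)
    have hy3 := hypos T (hsub (right_mem_Icc.2 hle))
    have hL : 0 ≤ Real.log (1 + 2 * ℓ) := Real.log_nonneg (by linarith)
    have hℓ2 : 0 < 1 + 2 * ℓ := by linarith
    rw [Real.rpow_def_of_pos hy2, Real.rpow_def_of_pos hℓ2, Real.rpow_def_of_pos hy1]
    nth_rewrite 1 [← Real.exp_log hy3]
    rw [← Real.exp_add, ← Real.exp_add, ← Real.exp_add, Real.exp_le_exp, hGℓ]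
    have p1 : 0 ≤ (1 + Mℓ) * C₁ * (1 / 2 - ℓ * ρ) :=
      mul_nonneg (mul_nonneg (by linarith) hC₁) (by linarith)
    have p2 : 0 ≤ Mℓ * (∫ t in (T - 2 * ℓ * ρ)..T, F t) * (1 - ℓ * ρ) :=
      mul_nonneg (mul_nonneg hM0 hJ) (by linarith)
    have p3 : 0 ≤ (1 + Mℓ) * (C₀ * Real.log (1 + 2 * ℓ)) :=
      mul_nonneg (by linarith) (mul_nonneg hC₀ hL)
    linear_combination hmain + 2 * p1 + p2 + p3 + hJ
  · have hv : ContinuousOn (fun t => (T - t + ρ) ^ (1 + C₀)) (Icc (T - 2 * ℓ * ρ) T) :=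
      hden.rpow_const fun t ht => Or.inl (hpos t ht).ne'
    have hratio := integral_inv_rpow_ratio_le (T := T) hρ hC₀ hℓ
    have hratio0 : 0 ≤ if C₀ = 0 then Real.log (1 + ℓ) / Real.log (3 / 2)
        else (1 + ℓ) ^ C₀ / (1 - (2 / 3 : ℝ) ^ C₀) := by
      split_ifs
      · exact div_nonneg (Real.log_nonneg (by linarith)) (Real.log_nonneg (by norm_num))
      · exact div_nonneg (Real.rpow_nonneg (by linarith) _)
          (sub_nonneg.2 (Real.rpow_le_one (by norm_num) (by norm_num) hC₀))
    calc Mℓ ≤ Real.exp (C₁ * (T - (T - 2 * ℓ * ρ))) * _ :=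
          hMℓ ▸ integral_exp_mul_div_le (by linarith) (by linarith) hC₁ hv
            fun t ht => Real.rpow_pos_of_pos (hpos t ht) _
      _ ≤ Real.exp C₁ * _ := by
        refine mul_le_mul (Real.exp_le_exp.2 (mul_le_of_le_one_right hC₁ (by linarith))) hratio ?_
          (Real.exp_pos _).le
        exact div_nonneg
          (integral_nonneg (by linarith) fun t ht =>
            (inv_pos.2 (Real.rpow_pos_of_pos (by linarith [ht.2]) _)).le)
          (integral_nonneg (by linarith) fun t ht =>
            (inv_pos.2 (Real.rpow_pos_of_pos (by linarith [ht.2]) _)).le)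
      _ = Sℓ := by rw [hSℓ]; split_ifs <;> ring
end

section
/- Let T > 0, ρ > 0, C₀ > 0, C₁ ≥ 0 and ℓ > 1 with ℓρ ≤ min{1/2, T/4}. Then ( ∫_{T−ℓρ}^{T} e^{C₁ s}/(T − s + ρ)^{1+C₀} ds ) / ( ∫_{T−2ℓρ}^{T−ℓρ} e^{C₁ s}/(T − s + ρ)^{1+C₀} ds ) ≤ e^{C₁} (1+ℓ)^{C₀}/(1 − (2/3)^{C₀}). -/
theorem continuousOn_one_div_rpow_sub_add {T ρ C a b : ℝ} (hab : a ≤ b) (hb : b < T + ρ) :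
    ContinuousOn (fun s : ℝ => 1 / (T - s + ρ) ^ (1 + C)) (Set.uIcc a b) := by
  rw [Set.uIcc_of_le hab]
  have hpos : ∀ s ∈ Set.Icc a b, 0 < T - s + ρ := fun s hs => by linarith [hs.2]
  refine continuousOn_const.div (ContinuousOn.rpow_const (by fun_prop) ?_) ?_
  · exact fun s hs => Or.inl (hpos s hs).ne'
  · exact fun s hs => (Real.rpow_pos_of_pos (hpos s hs) _).ne'

theorem integral_one_div_rpow_sub_add {T ρ C a b : ℝ} (hC : 0 < C) (hab : a ≤ b)
    (hb : b < T + ρ) :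
    ∫ s in a..b, 1 / (T - s + ρ) ^ (1 + C) =
      ((T - b + ρ) ^ (-C) - (T - a + ρ) ^ (-C)) / C := by
  rw [sub_div]
  refine intervalIntegral.integral_eq_sub_of_hasDerivAt
    (f := fun s => (T - s + ρ) ^ (-C) / C) (fun s hs => ?_)
    (continuousOn_one_div_rpow_sub_add hab hb).intervalIntegrable
  rw [Set.uIcc_of_le hab] at hs
  have hpos : 0 < T - s + ρ := by linarith [hs.2]
  have hlin : HasDerivAt (fun s : ℝ => T - s + ρ) (-1) s :=
    ((hasDerivAt_id s).const_sub T).add_const ρ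
  refine ((hlin.rpow_const (p := -C) (Or.inl hpos.ne')).div_const C).congr_deriv ?_
  rw [show -C - 1 = -(1 + C) by ring, Real.rpow_neg hpos.le]
  field_simp

theorem intervalIntegrable_exp_div_rpow_sub_add {T ρ C K a b : ℝ} (hab : a ≤ b)
    (hb : b < T + ρ) :
    IntervalIntegrable (fun s : ℝ => Real.exp (K * s) / (T - s + ρ) ^ (1 + C))
      MeasureTheory.volume a b := by
  simp_rw [div_eq_mul_one_div (Real.exp _)]
  exact (ContinuousOn.mul (by fun_prop)
    (continuousOn_one_div_rpow_sub_add hab hb)).intervalIntegrable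

theorem integral_exp_div_rpow_sub_add_le {T ρ C K a b : ℝ} (hC : 0 < C) (hK : 0 ≤ K)
    (hab : a ≤ b) (hb : b < T + ρ) :
    ∫ s in a..b, Real.exp (K * s) / (T - s + ρ) ^ (1 + C) ≤
      Real.exp (K * b) * (((T - b + ρ) ^ (-C) - (T - a + ρ) ^ (-C)) / C) := by
  rw [← integral_one_div_rpow_sub_add hC hab hb, ← intervalIntegral.integral_const_mul]
  refine intervalIntegral.integral_mono_on hab (intervalIntegrable_exp_div_rpow_sub_add hab hb)
    ((continuousOn_one_div_rpow_sub_add hab hb).intervalIntegrable.const_mul _) fun s hs => ?_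
  have hpos : 0 < T - s + ρ := by linarith [hs.2]
  rw [div_eq_mul_one_div]
  gcongr
  exact hs.2

theorem le_integral_exp_div_rpow_sub_add {T ρ C K a b : ℝ} (hC : 0 < C) (hK : 0 ≤ K)
    (hab : a ≤ b) (hb : b < T + ρ) :
    Real.exp (K * a) * (((T - b + ρ) ^ (-C) - (T - a + ρ) ^ (-C)) / C) ≤
      ∫ s in a..b, Real.exp (K * s) / (T - s + ρ) ^ (1 + C) := by
  rw [← integral_one_div_rpow_sub_add hC hab hb, ← intervalIntegral.integral_const_mul]
  refine intervalIntegral.integral_mono_on hab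
    ((continuousOn_one_div_rpow_sub_add hab hb).intervalIntegrable.const_mul _)
    (intervalIntegrable_exp_div_rpow_sub_add hab hb) fun s hs => ?_
  have hpos : 0 < T - s + ρ := by linarith [hs.2]
  rw [div_eq_mul_one_div (Real.exp (K * s))]
  gcongr
  exact hs.1

/-- Integral ratio estimate bounding the interpolation exponent `M_ℓ` in the case `C₀ > 0`. -/
theorem integral_ratio_C0_pos
    (T ρ C₀ C₁ ℓ : ℝ) (hT : 0 < T) (hρ : 0 < ρ) (hC₀ : 0 < C₀) (hC₁ : 0 ≤ C₁)
    (hℓ : 1 < ℓ) (hℓρ : ℓ * ρ ≤ min (1 / 2) (T / 4)) :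
    (∫ s in (T - ℓ * ρ)..T, Real.exp (C₁ * s) / (T - s + ρ) ^ (1 + C₀)) /
      (∫ s in (T - 2 * ℓ * ρ)..(T - ℓ * ρ), Real.exp (C₁ * s) / (T - s + ρ) ^ (1 + C₀)) ≤
    Real.exp C₁ * (1 + ℓ) ^ C₀ / (1 - (2 / 3 : ℝ) ^ C₀) := by
  have hℓ0 : 0 < ℓ * ρ := by positivity
  have hhalf : ℓ * ρ ≤ 1 / 2 := hℓρ.trans (min_le_left _ _)
  have hnum := integral_exp_div_rpow_sub_add_le (T := T) (ρ := ρ) (a := T - ℓ * ρ) (b := T)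
    hC₀ hC₁ (by linarith) (by linarith)
  have hden := le_integral_exp_div_rpow_sub_add (T := T) (ρ := ρ) (a := T - 2 * ℓ * ρ)
    (b := T - ℓ * ρ) hC₀ hC₁ (by linarith) (by linarith)
  rw [show T - T + ρ = ρ by ring, show T - (T - ℓ * ρ) + ρ = (1 + ℓ) * ρ by ring] at hnum
  rw [show T - (T - ℓ * ρ) + ρ = (1 + ℓ) * ρ by ring,
    show T - (T - 2 * ℓ * ρ) + ρ = (1 + 2 * ℓ) * ρ by ring] at hden
  set N := ∫ s in (T - ℓ * ρ)..T, Real.exp (C₁ * s) / (T - s + ρ) ^ (1 + C₀)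
  set D := ∫ s in (T - 2 * ℓ * ρ)..(T - ℓ * ρ), Real.exp (C₁ * s) / (T - s + ρ) ^ (1 + C₀)
  have hq : (2 / 3 : ℝ) ^ C₀ < 1 := Real.rpow_lt_one (by norm_num) (by norm_num) hC₀
  have hfar : ((1 + 2 * ℓ) * ρ) ^ (-C₀) ≤ (2 / 3 : ℝ) ^ C₀ * ((1 + ℓ) * ρ) ^ (-C₀) := by
    rw [Real.rpow_neg (by positivity), Real.rpow_neg (by positivity), ← div_eq_mul_inv,
      ← Real.div_rpow (by norm_num) (by positivity), ← Real.inv_rpow (by positivity)]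
    refine Real.rpow_le_rpow (by positivity) ?_ hC₀.le
    rw [inv_le_comm₀ (by positivity) (by positivity), inv_div, div_le_iff₀ (by norm_num)]
    nlinarith
  have hnear : ρ ^ (-C₀) = (1 + ℓ) ^ C₀ * ((1 + ℓ) * ρ) ^ (-C₀) := by
    rw [Real.mul_rpow (by positivity) hρ.le, ← mul_assoc, ← Real.rpow_add (by positivity),
      add_neg_cancel, Real.rpow_zero, one_mul]
  have hexp : Real.exp (C₁ * T) ≤ Real.exp C₁ * Real.exp (C₁ * (T - 2 * ℓ * ρ)) := by
    rw [← Real.exp_add, Real.exp_le_exp]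
    nlinarith
  have hP : 0 < ((1 + ℓ) * ρ) ^ (-C₀) := by positivity
  have hP₂ : 0 < ((1 + 2 * ℓ) * ρ) ^ (-C₀) := by positivity
  set P := ((1 + ℓ) * ρ) ^ (-C₀)
  have hq' : 0 < 1 - (2 / 3 : ℝ) ^ C₀ := by linarith
  have hD : Real.exp (C₁ * (T - 2 * ℓ * ρ)) * ((1 - (2 / 3 : ℝ) ^ C₀) * P / C₀) ≤ D := by
    refine le_trans ?_ hden
    gcongr
    linarith
  have hN : N ≤ Real.exp C₁ * Real.exp (C₁ * (T - 2 * ℓ * ρ)) * ((1 + ℓ) ^ C₀ * P / C₀) := by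
    refine hnum.trans ?_
    calc _ ≤ Real.exp (C₁ * T) * ((1 + ℓ) ^ C₀ * P / C₀) := by
          gcongr
          linarith
      _ ≤ _ := by gcongr
  have hDpos : 0 < D := lt_of_lt_of_le (by positivity) hD
  rw [div_le_div_iff₀ hDpos hq']
  calc _ ≤ Real.exp C₁ * Real.exp (C₁ * (T - 2 * ℓ * ρ)) * ((1 + ℓ) ^ C₀ * P / C₀) *
        (1 - (2 / 3 : ℝ) ^ C₀) := by gcongr
    _ = Real.exp C₁ * (1 + ℓ) ^ C₀ *
        (Real.exp (C₁ * (T - 2 * ℓ * ρ)) * ((1 - (2 / 3 : ℝ) ^ C₀) * P / C₀)) := by ring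
    _ ≤ _ := by gcongr
end

section
/- Let T > 0, p₂ > 0, Λ > 0, K > 0 and k ∈ (0,1). Let a, b, m, E be positive reals with m < a, and suppose: (i) b ≤ K e^{K/T} a^{1−k} m^{k}; (ii) a ≤ e^{p₂ T E²/a²} · b; and (iii) Λ a² ≤ E². Then, with C := √( max{ p₂/k , K/(kΛ) } ), one has a ≤ C √(1 + T + 1/T) · E / √( ln(a/m) ). -/
/-- Arithmetic form of the Appendix estimate: from the observation estimate
`b ≤ K e^{K/T} a^{1−k} m^k`, the backward stability estimate `a ≤ e^{p₂TE²/a²} b`, and the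
Poincaré inequality `Λa² ≤ E²`, one deduces
`a ≤ C √(1 + T + 1/T) E / √(ln(a/m))` with `C = √(max(p₂/k, K/(kΛ)))`. -/
theorem appendix_estimate
    (T p₂ Λ K k a b m E : ℝ)
    (hT : 0 < T) (hp₂ : 0 < p₂) (hΛ : 0 < Λ) (hK : 0 < K) (hk0 : 0 < k) (hk1 : k < 1)
    (ha : 0 < a) (hb : 0 < b) (hm : 0 < m) (hE : 0 < E) (hma : m < a)
    (h1 : b ≤ K * Real.exp (K / T) * a ^ (1 - k) * m ^ k)
    (h2 : a ≤ Real.exp (p₂ * T * E ^ 2 / a ^ 2) * b)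
    (h3 : Λ * a ^ 2 ≤ E ^ 2) :
    a ≤ Real.sqrt (max (p₂ / k) (K / (k * Λ))) * Real.sqrt (1 + T + 1 / T) * E /
      Real.sqrt (Real.log (a / m)) := by
  have hL : 0 < Real.log (a / m) := Real.log_pos ((one_lt_div hm).2 hma)
  have hlog2 : Real.log a ≤ p₂ * T * E ^ 2 / a ^ 2 + Real.log b := by
    have h := Real.log_le_log ha h2
    rwa [Real.log_mul (Real.exp_pos _).ne' hb.ne', Real.log_exp] at h
  have hlog1 : Real.log b ≤ Real.log K + K / T + (1 - k) * Real.log a + k * Real.log m := by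
    have h := Real.log_le_log hb h1
    rwa [Real.log_mul (by positivity) (by positivity), Real.log_mul (by positivity) (by positivity),
      Real.log_mul (by positivity) (by positivity), Real.log_exp, Real.log_rpow ha,
      Real.log_rpow hm] at h
  have hlogK : Real.log K ≤ K := Real.log_le_self hK.le
  have hpoincare : Λ ≤ E ^ 2 / a ^ 2 := (le_div_iff₀ (by positivity)).2 h3
  have hkL : k * Real.log (a / m) ≤ p₂ * T * (E ^ 2 / a ^ 2) + K * (1 + 1 / T) := by
    rw [Real.log_div ha.ne' hm.ne']
    have e1 : p₂ * T * (E ^ 2 / a ^ 2) = p₂ * T * E ^ 2 / a ^ 2 := by ring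
    have e2 : K * (1 + 1 / T) = K + K / T := by ring
    rw [e1, e2]
    linarith
  set M := max (p₂ / k) (K / (k * Λ))
  have hM0 : 0 < M := lt_max_of_lt_left (by positivity)
  have hp : p₂ ≤ M * k := (div_le_iff₀ hk0).1 (le_max_left _ _)
  have hKM : K ≤ M * (k * Λ) := (div_le_iff₀ (by positivity)).1 (le_max_right _ _)
  have hKX : K ≤ M * k * (E ^ 2 / a ^ 2) := by
    calc K ≤ M * k * Λ := by linarith
      _ ≤ _ := by gcongr
  have hLX : Real.log (a / m) ≤ M * (1 + T + 1 / T) * (E ^ 2 / a ^ 2) := by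
    refine le_of_mul_le_mul_left ?_ hk0
    calc k * Real.log (a / m)
        ≤ p₂ * T * (E ^ 2 / a ^ 2) + K * (1 + 1 / T) := hkL
      _ ≤ M * k * T * (E ^ 2 / a ^ 2) + M * k * (E ^ 2 / a ^ 2) * (1 + 1 / T) := by gcongr
      _ = _ := by ring
  rw [le_div_iff₀ (Real.sqrt_pos.2 hL)]
  refine (sq_le_sq₀ (by positivity) (by positivity)).1 ?_
  rw [mul_pow, mul_pow, mul_pow, Real.sq_sqrt hL.le, Real.sq_sqrt hM0.le,
    Real.sq_sqrt (by positivity)]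
  calc a ^ 2 * Real.log (a / m)
      ≤ a ^ 2 * (M * (1 + T + 1 / T) * (E ^ 2 / a ^ 2)) := by gcongr
    _ = _ := by field_simp
end
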